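/- Suppose that either G = Sym(n) with n even, n ≥ 4, or G = Alt(n) with n odd, n ≥ 5. Then γ(G) ≥ ⌈((n+1)/2)·(1 − √(1 − 8ζ₂(n) + 8f(n) + ((16n+8)/(n+1)²)·(ζ₂(n) − f(n))))⌉. -/

import Mathlib

/-- The normal covering number of a group `G`: the least `s` such that there exist
proper subgroups `H₁, …, H_s` of `G` with every element of `G` lying in some
conjugate of some `Hᵢ`. -/
noncomputable def normalCoveringNumber (G : Type*) [Group G] : ℕ :=
  sInf {s : ℕ | ∃ H : Fin s → Subgroup G, (∀ i, H i ≠ ⊤) ∧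
    ∀ g : G, ∃ i : Fin s, ∃ x : G, x * g * x⁻¹ ∈ H i}

/-- `ζ₂(n) = (1/12) ∏_{p ∣ n, p prime} (1 − 1/p²)`. -/
noncomputable def zeta2 (n : ℕ) : ℝ :=
  (1 / 12) * ∏ p ∈ n.primeFactors, (1 - 1 / (p : ℝ) ^ 2)

/-- The auxiliary function `f(n)` of the paper. -/
noncomputable def fAux (n : ℕ) : ℝ :=
  if Even n then
    (1 / (n : ℝ) ^ 2) * ((Real.logb 3 n + 1) / 4) * ((n - 1).primeFactors.card) +
      2 / (n : ℝ) ^ 2 + 2 / (n : ℝ) ^ ((1 : ℝ) / 2)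
  else
    (1 / (n : ℝ) ^ 2) * ((Real.logb 2 n + 1) / 2) * ((n - 1).primeFactors.card) +
      2 / (n : ℝ) ^ 2 + 2 / (n : ℝ) ^ ((1 : ℝ) / 2)

namespace NormalCovering

open scoped Pointwise

section CycleSets

variable {α : Type*}

/-- `A` is the set of points of a cycle (possibly of length one) of `g`. -/
def IsCycleSet (g : Equiv.Perm α) (A : Finset α) : Prop :=
  ∃ x, ∀ y, y ∈ A ↔ g.SameCycle x y

/-- `g` has exactly three cycles, with sets of points `A`, `B` and `C`. -/
structure ThreeCycles (g : Equiv.Perm α) (A B C : Finset α) : Prop where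
  left : IsCycleSet g A
  mid : IsCycleSet g B
  right : IsCycleSet g C
  left_mid : Disjoint A B
  left_right : Disjoint A C
  mid_right : Disjoint B C
  cover : ∀ x, x ∈ A ∨ x ∈ B ∨ x ∈ C

namespace IsCycleSet

variable {g : Equiv.Perm α} {A : Finset α}

theorem mem_iff_sameCycle (h : IsCycleSet g A) {x y : α} (hx : x ∈ A) :
    y ∈ A ↔ g.SameCycle x y := by
  obtain ⟨z, hz⟩ := h
  rw [hz] at hx
  rw [hz]
  exact ⟨fun hy => hx.symm.trans hy, fun hy => hx.trans hy⟩

theorem nonempty (h : IsCycleSet g A) : A.Nonempty := by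
  obtain ⟨z, hz⟩ := h
  exact ⟨z, (hz z).2 (Equiv.Perm.SameCycle.refl _ _)⟩

theorem zpow_apply_mem_iff (h : IsCycleSet g A) {x : α} (k : ℤ) : (g ^ k) x ∈ A ↔ x ∈ A := by
  obtain ⟨z, hz⟩ := h
  rw [hz, hz, Equiv.Perm.sameCycle_zpow_right]

theorem pow_apply_mem_iff (h : IsCycleSet g A) {x : α} (k : ℕ) : (g ^ k) x ∈ A ↔ x ∈ A := by
  simpa using h.zpow_apply_mem_iff (x := x) (k : ℤ)

theorem exists_zpow (h : IsCycleSet g A) {x y : α} (hx : x ∈ A) (hy : y ∈ A) :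
    ∃ k : ℤ, (g ^ k) x = y :=
  (h.mem_iff_sameCycle hx).1 hy

theorem zpow_apply_eq_iff (h : IsCycleSet g A) {x : α} (hx : x ∈ A) (k : ℤ) :
    (g ^ k) x = x ↔ (A.card : ℤ) ∣ k := by
  have horb : MulAction.orbit (Subgroup.zpowers g) x = (A : Set α) := by
    ext y
    rw [Finset.mem_coe, h.mem_iff_sameCycle hx]
    constructor
    · rintro ⟨⟨_, k, rfl⟩, rfl⟩
      exact ⟨k, rfl⟩
    · rintro ⟨k, rfl⟩
      exact ⟨⟨g ^ k, k, rfl⟩, rfl⟩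
  have hcard : Function.minimalPeriod (g • ·) x = A.card := by
    have : Fintype (MulAction.orbit (Subgroup.zpowers g) x) := by
      rw [horb]; infer_instance
    rw [MulAction.minimalPeriod_eq_card, ← Nat.card_eq_fintype_card, horb]
    simp
  rw [← hcard, ← MulAction.zpow_smul_eq_iff_minimalPeriod_dvd]
  rfl

theorem pow_apply_eq_iff (h : IsCycleSet g A) {x : α} (hx : x ∈ A) (k : ℕ) :
    (g ^ k) x = x ↔ A.card ∣ k := by
  rw [← Int.natCast_dvd_natCast, ← h.zpow_apply_eq_iff hx, zpow_natCast]

theorem conj [DecidableEq α] (h : IsCycleSet g A) (f : Equiv.Perm α) :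
    IsCycleSet (f * g * f⁻¹) (A.map f.toEmbedding) := by
  obtain ⟨z, hz⟩ := h
  refine ⟨f z, fun y => ?_⟩
  rw [Equiv.Perm.sameCycle_conj]
  simp [hz, Finset.mem_map_equiv, Equiv.Perm.inv_def]

end IsCycleSet

namespace ThreeCycles

variable {g : Equiv.Perm α} {A B C : Finset α}

theorem swap (h : ThreeCycles g A B C) : ThreeCycles g B A C :=
  ⟨h.mid, h.left, h.right, h.left_mid.symm, h.mid_right, h.left_right,
    fun x => by have := h.cover x; tauto⟩

theorem rotate (h : ThreeCycles g A B C) : ThreeCycles g B C A :=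
  ⟨h.mid, h.right, h.left, h.mid_right, h.left_mid.symm, h.left_right.symm,
    fun x => by have := h.cover x; tauto⟩

theorem conj [DecidableEq α] (h : ThreeCycles g A B C) (f : Equiv.Perm α) :
    ThreeCycles (f * g * f⁻¹) (A.map f.toEmbedding) (B.map f.toEmbedding)
      (C.map f.toEmbedding) where
  left := h.left.conj f
  mid := h.mid.conj f
  right := h.right.conj f
  left_mid := (Finset.disjoint_map _).2 h.left_mid
  left_right := (Finset.disjoint_map _).2 h.left_right
  mid_right := (Finset.disjoint_map _).2 h.mid_right
  cover x := by
    simpa [Finset.mem_map_equiv] using h.cover (f.symm x)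

theorem card_add [Fintype α] (h : ThreeCycles g A B C) :
    A.card + B.card + C.card = Fintype.card α := by
  classical
  rw [← Finset.card_union_of_disjoint h.left_mid, ← Finset.card_union_of_disjoint,
    ← Finset.card_univ]
  · congr 1
    ext x
    simpa [or_assoc] using h.cover x
  · exact Finset.disjoint_union_left.2 ⟨h.left_right, h.mid_right⟩

end ThreeCycles

end CycleSets

section Intransitive

variable {α : Type*}
variable {g : Equiv.Perm α} {A B C : Finset α}

theorem IsCycleSet.card_inter [DecidableEq α] {O : Finset α} (h : IsCycleSet g A)
    (hO : ∀ k : ℤ, ∀ x ∈ O, (g ^ k) x ∈ O) : (O ∩ A).card = 0 ∨ (O ∩ A).card = A.card := by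
  by_cases hx : ∃ x ∈ O, x ∈ A
  · obtain ⟨x, hxO, hxA⟩ := hx
    right
    congr 1
    refine Finset.inter_eq_right.2 fun y hy => ?_
    obtain ⟨k, rfl⟩ := h.exists_zpow hxA hy
    exact hO k x hxO
  · left
    push Not at hx
    rw [Finset.card_eq_zero, ← Finset.disjoint_iff_inter_eq_empty, Finset.disjoint_left]
    exact hx

theorem ThreeCycles.card_mem_of_invariant [Fintype α] [DecidableEq α] {O : Finset α}
    (h : ThreeCycles g A B C) (hO : ∀ k : ℤ, ∀ x ∈ O, (g ^ k) x ∈ O) (hne : O.Nonempty)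
    (hun : O ≠ Finset.univ) :
    O.card ∈ ({A.card, B.card, C.card} : Multiset ℕ) ∨
      Fintype.card α - O.card ∈ ({A.card, B.card, C.card} : Multiset ℕ) := by
  have hsum : (O ∩ A).card + (O ∩ B).card + (O ∩ C).card = O.card := by
    rw [← Finset.card_union_of_disjoint, ← Finset.card_union_of_disjoint]
    · congr 1
      ext x
      have := h.cover x
      simp only [Finset.mem_union, Finset.mem_inter]
      tauto
    · rw [Finset.disjoint_union_left]
      exact ⟨h.left_right.mono Finset.inter_subset_right Finset.inter_subset_right,
        h.mid_right.mono Finset.inter_subset_right Finset.inter_subset_right⟩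
    · exact h.left_mid.mono Finset.inter_subset_right Finset.inter_subset_right
  have hpos := hne.card_pos
  have hlt : O.card < Fintype.card α := (Finset.card_lt_iff_ne_univ O).2 hun
  have hcard := h.card_add
  simp only [Multiset.insert_eq_cons, Multiset.mem_cons, Multiset.mem_singleton]
  have h1 := h.left.card_inter hO
  have h2 := h.mid.card_inter hO
  have h3 := h.right.card_inter hO
  omega

theorem exists_card_mem_of_not_isPretransitive [Fintype α] (H : Subgroup (Equiv.Perm α))
    (hH : ¬ MulAction.IsPretransitive H α) :
    ∃ k, 1 ≤ k ∧ 2 * k ≤ Fintype.card α ∧ ∀ g ∈ H, ∀ A B C, ThreeCycles g A B C →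
      k ∈ ({A.card, B.card, C.card} : Multiset ℕ) ∨
        Fintype.card α - k ∈ ({A.card, B.card, C.card} : Multiset ℕ) := by
  classical
  have hex : ∃ x y : α, y ∉ MulAction.orbit H x := by
    by_contra! hcon
    exact hH ⟨fun x y => hcon x y⟩
  obtain ⟨x, y, hxy⟩ := hex
  let O : Finset α := Finset.univ.filter (· ∈ MulAction.orbit H x)
  have hne : O.Nonempty := ⟨x, by simp [O]⟩
  have hun : O ≠ Finset.univ := fun h =>
    hxy ((Finset.mem_filter.1 (h.symm ▸ Finset.mem_univ y : y ∈ O)).2)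
  have hO : ∀ g ∈ H, ∀ z ∈ O, g z ∈ O := by
    intro g hg z hz
    simp only [O, Finset.mem_filter, Finset.mem_univ, true_and] at hz ⊢
    exact MulAction.mem_orbit_of_mem_orbit (⟨g, hg⟩ : H) hz
  have hpos := hne.card_pos
  have hlt : O.card < Fintype.card α := (Finset.card_lt_iff_ne_univ O).2 hun
  have key : ∀ g ∈ H, ∀ A B C, ThreeCycles g A B C →
      O.card ∈ ({A.card, B.card, C.card} : Multiset ℕ) ∨
        Fintype.card α - O.card ∈ ({A.card, B.card, C.card} : Multiset ℕ) :=
    fun g hg A B C h => h.card_mem_of_invariant (fun k => hO _ (H.zpow_mem hg k)) hne hun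
  by_cases hk : 2 * O.card ≤ Fintype.card α
  · exact ⟨O.card, hpos, hk, key⟩
  · refine ⟨Fintype.card α - O.card, by omega, by omega, fun g hg A B C h => ?_⟩
    rw [Nat.sub_sub_self hlt.le]
    exact (key g hg A B C h).symm

end Intransitive

section Imprimitive

variable {α : Type*}
variable {g : Equiv.Perm α} {A B C : Finset α}

theorem exists_period (r : Setoid α) (hr : ∀ x y, r x y → r (g x) (g y)) [Finite α] (p : α) :
    ∃ l : ℕ, ∀ q, r p q → ∀ k : ℤ, r q ((g ^ k) q) ↔ (l : ℤ) ∣ k := by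
  have hpow : ∀ k : ℕ, ∀ x y, r x y → r ((g ^ k) x) ((g ^ k) y) := by
    intro k
    induction k with
    | zero => simp
    | succ k ih =>
      intro x y hxy
      rw [pow_succ']
      exact hr _ _ (ih x y hxy)
  have hz : ∀ k : ℤ, ∀ x y, r x y → r ((g ^ k) x) ((g ^ k) y) := by
    intro k x y hxy
    obtain ⟨m, hm⟩ : ∃ m : ℕ, g ^ m = g ^ k := by
      have := (mem_powers_iff_mem_zpowers (x := g) (y := g ^ k)).2 ⟨k, rfl⟩
      exact this
    rw [← hm]
    exact hpow m x y hxy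
  let S : AddSubgroup ℤ :=
    { carrier := {k | r p ((g ^ k) p)}
      zero_mem' := by simp
      add_mem' := by
        intro a b ha hb
        have := hz a _ _ hb
        rw [← Equiv.Perm.mul_apply, ← zpow_add] at this
        exact r.trans ha this
      neg_mem' := by
        intro a ha
        have := hz (-a) _ _ ha
        rw [← Equiv.Perm.mul_apply, ← zpow_add] at this
        exact r.symm (by simpa using this) }
  obtain ⟨a, ha⟩ := Int.subgroup_cyclic S
  refine ⟨a.natAbs, fun q hq k => ?_⟩
  have h1 : r p ((g ^ k) p) ↔ a ∣ k := by
    change k ∈ S ↔ _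
    rw [ha, AddSubgroup.mem_closure_singleton]
    simp [dvd_iff_exists_eq_mul_left, eq_comm]
  rw [Int.natAbs_dvd, ← h1]
  exact ⟨fun h => r.trans (r.trans hq h) (r.symm (hz k _ _ hq)),
    fun h => r.trans (r.trans (r.symm hq) h) (hz k _ _ hq)⟩

theorem IsCycleSet.card_eq_mul (r : Setoid α) [DecidableRel r] [DecidableEq α]
    (h : IsCycleSet g A) {q : α} (hq : q ∈ A) {l : ℕ}
    (hl : ∀ k : ℤ, r q ((g ^ k) q) ↔ (l : ℤ) ∣ k) :
    A.card = l * (A.filter (r q)).card := by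
  have hdvd : l ∣ A.card := by
    have h1 : (g ^ (A.card : ℤ)) q = q := (h.zpow_apply_eq_iff hq _).2 dvd_rfl
    rw [← Int.natCast_dvd_natCast, ← hl, h1]
  obtain ⟨c, hc⟩ := hdvd
  have hA : 0 < A.card := Finset.card_pos.2 h.nonempty
  have hl0 : l ≠ 0 := by rintro rfl; rw [zero_mul] at hc; omega
  have himg : A.filter (r q) = (Finset.range c).image (fun j => (g ^ (l * j)) q) := by
    ext y
    simp only [Finset.mem_filter, Finset.mem_image, Finset.mem_range]
    constructor
    · rintro ⟨hy, hry⟩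
      obtain ⟨k, rfl⟩ := h.exists_zpow hq hy
      obtain ⟨j, rfl⟩ := (hl k).1 hry
      have hc0 : (0 : ℤ) < c := by
        rcases Nat.eq_zero_or_pos c with rfl | h0
        · rw [mul_zero] at hc; omega
        · exact_mod_cast h0
      refine ⟨(j % c).toNat, ?_, ?_⟩
      · have := Int.emod_lt_of_pos j hc0
        have := Int.emod_nonneg j hc0.ne'
        omega
      · have hj : ((l * (j % c).toNat : ℕ) : ℤ) = l * j - A.card * (j / c) := by
          push_cast
          rw [Int.toNat_of_nonneg (Int.emod_nonneg j hc0.ne'), hc, Int.emod_def]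
          push_cast
          ring
        rw [← zpow_natCast, hj, zpow_sub, Equiv.Perm.mul_apply, ← zpow_neg,
          (h.zpow_apply_eq_iff hq _).2 (Dvd.intro _ (by ring : (A.card : ℤ) * -(j / c) = _))]
    · rintro ⟨j, -, rfl⟩
      refine ⟨(h.pow_apply_mem_iff _).2 hq, ?_⟩
      have := (hl (l * j : ℕ)).2 ⟨j, by push_cast; ring⟩
      rwa [zpow_natCast] at this
  rw [himg, Finset.card_image_of_injOn, Finset.card_range, hc]
  intro i hi j hj hij
  simp only [Finset.coe_range, Set.mem_Iio] at hi hj hij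
  have h1 : (g ^ ((l * i : ℕ) - (l * j : ℕ) : ℤ)) q = q := by
    rw [sub_eq_neg_add, zpow_add, Equiv.Perm.mul_apply, zpow_natCast, hij, ← zpow_natCast,
      ← Equiv.Perm.mul_apply, ← zpow_add]
    simp
  rw [h.zpow_apply_eq_iff hq, hc] at h1
  push_cast at h1
  rw [← mul_sub, mul_dvd_mul_iff_left (by exact_mod_cast hl0)] at h1
  have := Int.eq_zero_of_abs_lt_dvd h1 (by rw [abs_lt]; omega)
  omega

theorem ThreeCycles.card_eq_of_rel [Fintype α] (r : Setoid α)
    (hr : ∀ x y, r x y → r (g x) (g y)) {m : ℕ}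
    (hm : ∀ x, {y | r x y}.ncard = m) (hmn : m < Fintype.card α) (h : ThreeCycles g A B C)
    (hgcd : Nat.gcd A.card (Nat.gcd B.card C.card) = 1)
    {p q : α} (hp : p ∈ A) (hq : q ∈ B) (hpq : r p q) :
    ∃ l x, 1 ≤ l ∧ 1 ≤ x ∧ x < m ∧ A.card = l * x ∧ B.card = l * (m - x) := by
  classical
  obtain ⟨l, hl⟩ := exists_period r hr p
  have hfil : ∀ q, r p q → ∀ D : Finset α, D.filter (r q) = D.filter (r p) := by
    intro q hq D
    refine Finset.filter_congr fun x _ => ?_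
    exact ⟨fun hx => r.trans hq hx, fun hx => r.trans (r.symm hq) hx⟩
  have hA := h.left.card_eq_mul r hp (hl p (r.refl p))
  have hB := h.mid.card_eq_mul r hq (hl q hpq)
  rw [hfil q hpq] at hB
  have hsum : (A.filter (r p)).card + (B.filter (r p)).card + (C.filter (r p)).card = m := by
    rw [← hm p, ← Finset.card_union_of_disjoint, ← Finset.card_union_of_disjoint,
      ← Set.ncard_coe_finset]
    · congr 1
      ext x
      have := h.cover x
      simp only [Finset.coe_union, Finset.coe_filter, Set.mem_union, Set.mem_ofPred_eq]
      tauto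
    · rw [Finset.disjoint_union_left]
      exact ⟨Finset.disjoint_filter_filter h.left_right, Finset.disjoint_filter_filter h.mid_right⟩
    · exact Finset.disjoint_filter_filter h.left_mid
  have hApos := Finset.card_pos.2 h.left.nonempty
  have hBpos := Finset.card_pos.2 h.mid.nonempty
  have hC : (C.filter (r p)).card = 0 := by
    by_contra hne
    obtain ⟨z, hz⟩ := Finset.card_pos.1 (Nat.pos_of_ne_zero hne)
    rw [Finset.mem_filter] at hz
    have hC := h.right.card_eq_mul r hz.1 (hl z hz.2)
    rw [hfil z hz.2] at hC
    have : l ∣ 1 := by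
      rw [← hgcd]
      exact Nat.dvd_gcd ⟨_, hA⟩ (Nat.dvd_gcd ⟨_, hB⟩ ⟨_, hC⟩)
    rw [Nat.dvd_one.1 this, one_mul] at hA hB hC
    have := h.card_add
    omega
  refine ⟨l, (A.filter (r p)).card, ?_, ?_, ?_, hA, ?_⟩
  · by_contra! h0
    obtain rfl : l = 0 := by omega
    omega
  · by_contra! h0
    have : (A.filter (r p)).card = 0 := by omega
    rw [this, mul_zero] at hA
    omega
  · have : (B.filter (r p)).card ≠ 0 := by
      intro this
      rw [this, mul_zero] at hB
      omega
    omega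
  · rw [hB]
    congr 1
    omega

theorem ThreeCycles.card_dvd_of_not_rel [Fintype α] (r : Setoid α)
    (hr : ∀ x y, r x y → r (g x) (g y)) {m : ℕ}
    (hm : ∀ x, {y | r x y}.ncard = m) (h : ThreeCycles g A B C)
    (hAB : ∀ p ∈ A, ∀ q ∈ B, ¬ r p q) (hAC : ∀ p ∈ A, ∀ q ∈ C, ¬ r p q) : m ∣ A.card := by
  classical
  obtain ⟨p, hp⟩ := h.left.nonempty
  obtain ⟨l, hl⟩ := exists_period r hr p
  refine ⟨l, ?_⟩
  rw [h.left.card_eq_mul r hp (hl p (r.refl p)), ← hm p, mul_comm, ← Set.ncard_coe_finset]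
  congr 2
  ext x
  simp only [Finset.coe_filter, Set.mem_ofPred_eq]
  refine ⟨fun hx => hx.2, fun hx => ⟨?_, hx⟩⟩
  rcases h.cover x with h1 | h1 | h1
  · exact h1
  · exact absurd hx (hAB p hp x h1)
  · exact absurd hx (hAC p hp x h1)

/-- The possible cycle types, with three cycles, of elements of imprimitive groups. -/
def IsImprimitiveTriple (n : ℕ) (T : Multiset ℕ) : Prop :=
  ∃ m l x, m ∣ n ∧ 1 < m ∧ m < n ∧ 1 ≤ l ∧ l * m < n ∧ 1 ≤ x ∧ 2 * x ≤ m ∧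
    T = {l * x, l * (m - x), n - l * m}

theorem ThreeCycles.isImprimitiveTriple_of_rel [Fintype α] (r : Setoid α)
    (hr : ∀ x y, r x y → r (g x) (g y)) {m : ℕ}
    (hm : ∀ x, {y | r x y}.ncard = m) (hm1 : 1 < m) (hmn : m < Fintype.card α)
    (hdvd : m ∣ Fintype.card α) (h : ThreeCycles g A B C)
    (hgcd : Nat.gcd A.card (Nat.gcd B.card C.card) = 1)
    {p q : α} (hp : p ∈ A) (hq : q ∈ B) (hpq : r p q) :
    IsImprimitiveTriple (Fintype.card α) {A.card, B.card, C.card} := by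
  obtain ⟨l, x, hl, hx, hxm, hA, hB⟩ := h.card_eq_of_rel r hr hm hmn hgcd hp hq hpq
  have hsum := h.card_add
  have hC := Finset.card_pos.2 h.right.nonempty
  have hlm : l * x + l * (m - x) = l * m := by
    rw [← mul_add]
    congr 1
    omega
  rw [← hA, ← hB] at hlm
  have hC' : C.card = Fintype.card α - l * m := by omega
  rcases le_total (2 * x) m with h2 | h2
  · exact ⟨m, l, x, hdvd, hm1, hmn, hl, by omega, hx, h2, by rw [hA, hB, hC']⟩
  · refine ⟨m, l, m - x, hdvd, hm1, hmn, hl, by omega, by omega, by omega, ?_⟩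
    rw [Nat.sub_sub_self hxm.le, hA, hB, hC']
    exact Multiset.cons_swap _ _ _

theorem ThreeCycles.isImprimitiveTriple [Fintype α] (r : Setoid α)
    (hr : ∀ x y, r x y → r (g x) (g y)) {m : ℕ}
    (hm : ∀ x, {y | r x y}.ncard = m) (hm1 : 1 < m) (hmn : m < Fintype.card α)
    (hdvd : m ∣ Fintype.card α) (h : ThreeCycles g A B C)
    (hgcd : Nat.gcd A.card (Nat.gcd B.card C.card) = 1) :
    IsImprimitiveTriple (Fintype.card α) {A.card, B.card, C.card} := by
  have hgcd' : Nat.gcd B.card (Nat.gcd C.card A.card) = 1 := by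
    rw [← hgcd, ← Nat.gcd_assoc, Nat.gcd_comm]
  have hgcd'' : Nat.gcd C.card (Nat.gcd A.card B.card) = 1 := by
    rw [← hgcd, ← Nat.gcd_assoc A.card, Nat.gcd_comm]
  by_cases hAB : ∀ p ∈ A, ∀ q ∈ B, ¬ r p q
  · by_cases hBC : ∀ p ∈ B, ∀ q ∈ C, ¬ r p q
    · by_cases hCA : ∀ p ∈ C, ∀ q ∈ A, ¬ r p q
      · have h1 := h.card_dvd_of_not_rel r hr hm hAB
          (fun p hp q hq hpq => hCA q hq p hp (r.symm hpq))
        have h2 := h.rotate.card_dvd_of_not_rel r hr hm hBC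
          (fun p hp q hq hpq => hAB q hq p hp (r.symm hpq))
        have h3 := h.rotate.rotate.card_dvd_of_not_rel r hr hm hCA
          (fun p hp q hq hpq => hBC q hq p hp (r.symm hpq))
        have := Nat.dvd_gcd h1 (Nat.dvd_gcd h2 h3)
        rw [hgcd, Nat.dvd_one] at this
        omega
      · push Not at hCA
        obtain ⟨p, hp, q, hq, hpq⟩ := hCA
        have := h.rotate.rotate.isImprimitiveTriple_of_rel r hr hm hm1 hmn hdvd hgcd'' hp hq hpq
        convert this using 1
        simp only [Multiset.insert_eq_cons, ← Multiset.singleton_add]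
        abel
    · push Not at hBC
      obtain ⟨p, hp, q, hq, hpq⟩ := hBC
      have := h.rotate.isImprimitiveTriple_of_rel r hr hm hm1 hmn hdvd hgcd' hp hq hpq
      convert this using 1
      simp only [Multiset.insert_eq_cons, ← Multiset.singleton_add]
      abel
  · push Not at hAB
    obtain ⟨p, hp, q, hq, hpq⟩ := hAB
    exact h.isImprimitiveTriple_of_rel r hr hm hm1 hmn hdvd hgcd hp hq hpq

theorem isImprimitiveTriple_of_not_isPreprimitive [Fintype α] (H : Subgroup (Equiv.Perm α))
    [MulAction.IsPretransitive H α] (hH : ¬ MulAction.IsPreprimitive H α) (hg : g ∈ H)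
    (h : ThreeCycles g A B C) (hgcd : Nat.gcd A.card (Nat.gcd B.card C.card) = 1) :
    IsImprimitiveTriple (Fintype.card α) {A.card, B.card, C.card} := by
  have hex : ∃ D : Set α, MulAction.IsBlock H D ∧ ¬ MulAction.IsTrivialBlock D := by
    by_contra! hcon
    exact hH ⟨fun {D} hD => hcon D hD⟩
  obtain ⟨D, hD, hDt⟩ := hex
  rw [MulAction.IsTrivialBlock, not_or, Set.not_subsingleton_iff] at hDt
  let r : Setoid α :=
    { r := fun x y => ∀ u : H, x ∈ u • D ↔ y ∈ u • D
      iseqv := ⟨fun _ _ => Iff.rfl, fun h u => (h u).symm, fun h h' u => (h u).trans (h' u)⟩ }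
  have hDn : D.Nonempty := hDt.1.nonempty
  have hr : ∀ x y, r x y → r (g x) (g y) := by
    intro x y hxy u
    have := hxy ((⟨g, hg⟩ : H)⁻¹ * u)
    rw [mul_smul, Set.mem_inv_smul_set_iff, Set.mem_inv_smul_set_iff] at this
    exact this
  have hm : ∀ x, {y | r x y}.ncard = D.ncard := by
    intro x
    obtain ⟨d, hd⟩ := hDn
    obtain ⟨u, rfl⟩ := MulAction.exists_smul_eq H d x
    have : {y | r (u • d) y} = u • D := by
      ext y
      refine ⟨fun hy => (hy u).1 (Set.smul_mem_smul_set hd), fun hy v => ?_⟩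
      by_cases huv : u • D = v • D
      · rw [← huv]
        exact iff_of_true (Set.smul_mem_smul_set hd) hy
      · have := Set.disjoint_left.1 (hD huv)
        exact iff_of_false (this (Set.smul_mem_smul_set hd)) (this hy)
    rw [this, Set.ncard_smul_set]
  refine h.isImprimitiveTriple r hr hm ?_ ?_ ?_ hgcd
  · exact (Set.one_lt_ncard (Set.toFinite D)).2 hDt.1
  · rw [← Nat.card_eq_fintype_card]
    exact Set.ncard_lt_card hDt.2
  · rw [← Nat.card_eq_fintype_card]
    exact hD.ncard_dvd_card hDn

end Imprimitive

section PrimitiveNotTwoTransitive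

variable {α : Type*}
variable {g : Equiv.Perm α} {A B C : Finset α}

/-- The points whose stabilizer in `H` does not send `x` to `y`. -/
def separators (H : Subgroup (Equiv.Perm α)) (x y : α) : Set α :=
  {z | ∀ u ∈ H, u z = z → u x ≠ y}

variable {H : Subgroup (Equiv.Perm α)}

theorem notMem_separators {x y z : α} :
    z ∉ separators H x y ↔ ∃ u ∈ H, u z = z ∧ u x = y := by
  simp [separators]

theorem separators_comm (x y : α) : separators H x y = separators H y x := by
  ext z
  rw [← not_iff_not, notMem_separators, notMem_separators]
  constructor <;>
  · rintro ⟨u, hu, hz, h⟩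
    refine ⟨u⁻¹, H.inv_mem hu, ?_, ?_⟩
    · rw [Equiv.Perm.inv_eq_iff_eq, hz]
    · rw [Equiv.Perm.inv_eq_iff_eq, h]

theorem ncard_separators_apply {k : Equiv.Perm α} (hk : k ∈ H) (x y : α) :
    (separators H (k x) (k y)).ncard = (separators H x y).ncard := by
  rw [← Set.ncard_image_of_injective (separators H x y) k.injective]
  congr 1
  ext z
  rw [Equiv.image_eq_preimage_symm, Set.mem_preimage, ← not_iff_not, notMem_separators,
    notMem_separators]
  constructor
  · rintro ⟨u, hu, hz, h⟩
    refine ⟨k⁻¹ * u * k, H.mul_mem (H.mul_mem (H.inv_mem hk) hu) hk, ?_, ?_⟩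
    · simp [hz, Equiv.Perm.inv_def]
    · simp [h, Equiv.Perm.inv_def]
  · rintro ⟨u, hu, hz, h⟩
    refine ⟨k * u * k⁻¹, H.mul_mem (H.mul_mem hk hu) (H.inv_mem hk), ?_, ?_⟩
    · simp [hz, Equiv.Perm.inv_def]
    · simp [h, Equiv.Perm.inv_def]

theorem ThreeCycles.le_two_mul_ncard_separators [Finite α] (h : ThreeCycles g A B C)
    (hg : g ∈ H) (hB : ¬ B.card ∣ Nat.lcm A.card C.card) {x y : α} (hx : x ∈ B) (hy : y ∈ C)
    {d : ℕ} (hd : ∀ x y, x ≠ y → d ≤ (separators H x y).ncard) :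
    d ≤ 2 * (separators H x y ∩ B).ncard := by
  set s := g ^ Nat.lcm A.card C.card with hs
  have hsH : s ∈ H := H.pow_mem hg _
  have hfix : ∀ z, z ∉ B → s z = z := by
    intro z hz
    rcases h.cover z with h1 | h1 | h1
    · exact (h.left.pow_apply_eq_iff h1 _).2 (Nat.dvd_lcm_left _ _)
    · exact absurd h1 hz
    · exact (h.right.pow_apply_eq_iff h1 _).2 (Nat.dvd_lcm_right _ _)
  have hsx : x ≠ s x := fun hsx => hB ((h.mid.pow_apply_eq_iff hx _).1 hsx.symm)
  have hsy : s y = y := hfix y (Finset.disjoint_right.1 h.mid_right hy)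
  set J := separators H x y ∩ B with hJ
  have hsub : separators H x (s x) ⊆ J ∪ s '' J := by
    intro z hz
    have hzB : z ∈ B := by
      by_contra hzB
      exact hz s hsH (hfix z hzB) rfl
    by_contra hcon
    rw [Set.mem_union, not_or] at hcon
    obtain ⟨h1, h2⟩ := hcon
    have h1' : z ∉ separators H x y := fun h' => h1 ⟨h', hzB⟩
    have h2' : s⁻¹ z ∉ separators H x y := by
      intro h'
      refine h2 ⟨s⁻¹ z, ⟨h', ?_⟩, by simp⟩
      rw [Finset.mem_coe, ← h.mid.pow_apply_mem_iff (Nat.lcm A.card C.card), ← hs]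
      simpa using hzB
    rw [notMem_separators] at h1' h2'
    obtain ⟨u, hu, huz, hux⟩ := h1'
    obtain ⟨v, hv, hvz, hvx⟩ := h2'
    refine hz (s * v⁻¹ * s⁻¹ * u) (H.mul_mem (H.mul_mem (H.mul_mem hsH (H.inv_mem hv))
      (H.inv_mem hsH)) hu) ?_ ?_
    · have : v⁻¹ (s⁻¹ z) = s⁻¹ z := by rw [Equiv.Perm.inv_eq_iff_eq, hvz]
      simp only [Equiv.Perm.mul_apply, huz, this]
      simp
    · have h3 : s⁻¹ y = y := by rw [Equiv.Perm.inv_eq_iff_eq, hsy]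
      have h4 : v⁻¹ y = x := by rw [Equiv.Perm.inv_eq_iff_eq, hvx]
      simp only [Equiv.Perm.mul_apply, hux, h3, h4]
  calc d ≤ (separators H x (s x)).ncard := hd _ _ hsx
    _ ≤ (J ∪ s '' J).ncard := Set.ncard_le_ncard hsub
    _ ≤ J.ncard + (s '' J).ncard := Set.ncard_union_le _ _
    _ = 2 * J.ncard := by rw [Set.ncard_image_of_injective _ s.injective, two_mul]

theorem ThreeCycles.notMem_separators [Finite α] (h : ThreeCycles g A B C)
    (hg : g ∈ H) (hB : ¬ B.card ∣ Nat.lcm A.card C.card) (hC : ¬ C.card ∣ Nat.lcm A.card B.card)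
    {x y : α} (hx : x ∈ B) (hy : y ∈ C)
    (hd : ∀ x' y', x' ≠ y' → (separators H x y).ncard ≤ (separators H x' y').ncard) :
    ∀ z ∈ A, z ∉ separators H x y := by
  intro z hz hzD
  have h1 := h.le_two_mul_ncard_separators hg hB hx hy hd
  have h2 : (separators H x y).ncard ≤ 2 * (separators H x y ∩ C).ncard := by
    rw [separators_comm x y] at hd ⊢
    exact (h.rotate.swap.rotate.rotate).le_two_mul_ncard_separators hg hC hy hx hd
  have h3 : (separators H x y ∩ A).ncard ≠ 0 := Set.ncard_ne_zero_of_mem ⟨hzD, hz⟩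
  have h4 : (separators H x y ∩ A).ncard + (separators H x y ∩ B).ncard +
      (separators H x y ∩ C).ncard ≤ (separators H x y).ncard := by
    rw [← Set.ncard_union_eq, ← Set.ncard_union_eq]
    · refine Set.ncard_le_ncard ?_
      rintro w ((hw | hw) | hw) <;> exact hw.1
    · rw [Set.disjoint_union_left]
      exact ⟨(Finset.disjoint_coe.2 h.left_right).mono Set.inter_subset_right
          Set.inter_subset_right,
        (Finset.disjoint_coe.2 h.mid_right).mono Set.inter_subset_right Set.inter_subset_right⟩
    · exact (Finset.disjoint_coe.2 h.left_mid).mono Set.inter_subset_right Set.inter_subset_right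
  omega

theorem exists_stabilizer_conj {k : Equiv.Perm α} (hk : k ∈ H) {z x y : α}
    (h : ∃ u ∈ H, u z = z ∧ u x = y) : ∃ u ∈ H, u (k z) = k z ∧ u (k x) = k y := by
  obtain ⟨u, hu, hz, hx⟩ := h
  exact ⟨k * u * k⁻¹, H.mul_mem (H.mul_mem hk hu) (H.inv_mem hk), by simp [hz], by simp [hx]⟩

theorem exists_stabilizer_trans {z x y w : α} (h : ∃ u ∈ H, u z = z ∧ u x = y)
    (h' : ∃ u ∈ H, u z = z ∧ u y = w) : ∃ u ∈ H, u z = z ∧ u x = w := by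
  obtain ⟨u, hu, hz, hx⟩ := h
  obtain ⟨v, hv, hz', hx'⟩ := h'
  exact ⟨v * u, H.mul_mem hv hu, by simp [hz, hz'], by simp [hx, hx']⟩

theorem exists_stabilizer_symm {z x y : α} (h : ∃ u ∈ H, u z = z ∧ u x = y) :
    ∃ u ∈ H, u z = z ∧ u y = x := by
  obtain ⟨u, hu, hz, hx⟩ := h
  exact ⟨u⁻¹, H.inv_mem hu, by rw [Equiv.Perm.inv_eq_iff_eq, hz],
    by rw [Equiv.Perm.inv_eq_iff_eq, hx]⟩

theorem ThreeCycles.exists_stabilizer (h : ThreeCycles g A B C)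
    (hg : g ∈ H) (hgcd : Nat.gcd A.card (Nat.gcd B.card C.card) = 1)
    {x y : α} (hx : x ∈ B) (hy : y ∈ C) (hd : ∀ z ∈ A, ∃ u ∈ H, u z = z ∧ u x = y) :
    ∀ z ∈ A, ∀ w, w ∉ A → ∃ u ∈ H, u z = z ∧ u x = w := by
  have hgk : ∀ k : ℤ, g ^ k ∈ H := H.zpow_mem hg
  have hshift : ∀ k : ℤ, ∀ x y, (∀ z ∈ A, ∃ u ∈ H, u z = z ∧ u x = y) →
      ∀ z ∈ A, ∃ u ∈ H, u z = z ∧ u ((g ^ k) x) = (g ^ k) y := by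
    intro k x y hxy z hz
    have := exists_stabilizer_conj (hgk k) (hxy ((g ^ (-k)) z) ((h.left.zpow_apply_mem_iff _).2 hz))
    simpa using this
  let S : AddSubgroup ℤ :=
    { carrier := {k | ∀ z ∈ A, ∃ u ∈ H, u z = z ∧ u x = (g ^ k) x}
      zero_mem' := fun z _ => ⟨1, H.one_mem, by simp, by simp⟩
      add_mem' := by
        intro a b ha hb z hz
        have := hshift a _ _ hb z hz
        rw [← Equiv.Perm.mul_apply, ← zpow_add] at this
        exact exists_stabilizer_trans (ha z hz) this
      neg_mem' := by
        intro a ha z hz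
        have := hshift (-a) _ _ ha z hz
        rw [← Equiv.Perm.mul_apply, ← zpow_add, neg_add_cancel, zpow_zero,
          Equiv.Perm.one_apply] at this
        exact exists_stabilizer_symm this }
  have hA : (A.card : ℤ) ∈ S := fun z hz =>
    ⟨g ^ (A.card : ℤ), hgk _, (h.left.zpow_apply_eq_iff hz _).2 dvd_rfl, rfl⟩
  have hB : (B.card : ℤ) ∈ S := fun z hz =>
    ⟨1, H.one_mem, rfl, ((h.mid.zpow_apply_eq_iff hx _).2 dvd_rfl).symm⟩
  have hC : (C.card : ℤ) ∈ S := by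
    intro z hz
    have := hshift C.card _ _ hd z hz
    rw [(h.right.zpow_apply_eq_iff hy _).2 dvd_rfl] at this
    exact exists_stabilizer_trans (hd z hz) (exists_stabilizer_symm this)
  have hS : ∀ k : ℤ, k ∈ S := by
    intro k
    obtain ⟨a, ha⟩ := Int.subgroup_cyclic S
    have hmem : ∀ k, k ∈ S ↔ a ∣ k := by
      intro k
      rw [ha, AddSubgroup.mem_closure_singleton]
      simp [dvd_iff_exists_eq_mul_left, eq_comm]
    rw [hmem, ← Int.natAbs_dvd, Int.natCast_dvd] at hA hB hC
    have := Nat.dvd_gcd hA (Nat.dvd_gcd hB hC)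
    simp only [Int.natAbs_natCast] at this
    rw [hgcd, Nat.dvd_one] at this
    rw [hmem, ← Int.natAbs_dvd, this]
    simp
  intro z hz w hw
  rcases h.cover w with h1 | h1 | h1
  · exact absurd h1 hw
  · obtain ⟨k, rfl⟩ := h.mid.exists_zpow hx h1
    exact hS k z hz
  · obtain ⟨k, rfl⟩ := h.right.exists_zpow hy h1
    exact exists_stabilizer_trans (hS k z hz) (hshift k _ _ hd z hz)

theorem ThreeCycles.exists_pair_map [Finite α] [MulAction.IsPreprimitive H α]
    (h : ThreeCycles g A B C) (hg : g ∈ H)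
    (hgcd : Nat.gcd A.card (Nat.gcd B.card C.card) = 1)
    (hB : ¬ B.card ∣ Nat.lcm A.card C.card) (hC : ¬ C.card ∣ Nat.lcm A.card B.card)
    {x y : α} (hx : x ∈ B) (hy : y ∈ C)
    (hd : ∀ x' y', x' ≠ y' → (separators H x y).ncard ≤ (separators H x' y').ncard) :
    ∃ p q : α, ∀ x' y', x' ≠ y' → ∃ u ∈ H, u p = x' ∧ u q = y' := by
  have hsep : ∀ z ∈ A, ∃ u ∈ H, u z = z ∧ u x = y := fun z hz =>
    NormalCovering.notMem_separators.1 (h.notMem_separators hg hB hC hx hy hd z hz)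
  have hst := h.exists_stabilizer hg hgcd hx hy hsep
  obtain ⟨p, hp⟩ := h.left.nonempty
  refine ⟨p, x, fun x' y' hne => ?_⟩
  have hA' : (A : Set α) ≠ Set.univ := by
    intro hA
    have : x ∈ (A : Set α) := hA ▸ Set.mem_univ x
    exact Finset.disjoint_left.1 h.left_mid this hx
  obtain ⟨v, hv1, hv2⟩ := MulAction.IsPreprimitive.exists_mem_smul_and_notMem_smul (G := H)
    A.finite_toSet h.left.nonempty hA' hne
  rw [Set.mem_smul_set_iff_inv_smul_mem] at hv1 hv2
  obtain ⟨k, hk⟩ := h.left.exists_zpow hp hv1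
  obtain ⟨u, hu, hup, hux⟩ := hst p hp ((g ^ (-k)) (v⁻¹ • y'))
    (fun hmem => hv2 ((h.left.zpow_apply_mem_iff _).1 hmem))
  refine ⟨v * g ^ k * u, H.mul_mem (H.mul_mem v.2 (H.zpow_mem hg k)) hu, ?_, ?_⟩
  · rw [Equiv.Perm.mul_apply, hup, Equiv.Perm.mul_apply, hk]
    exact smul_inv_smul v x'
  · rw [Equiv.Perm.mul_apply, hux, ← Equiv.Perm.mul_apply, mul_assoc, ← zpow_add, add_neg_cancel,
      zpow_zero, mul_one]
    exact smul_inv_smul v y'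

theorem ThreeCycles.isTwoTransitive [Finite α] [MulAction.IsPreprimitive H α]
    (h : ThreeCycles g A B C) (hg : g ∈ H)
    (hgcd : Nat.gcd A.card (Nat.gcd B.card C.card) = 1)
    (hA : ¬ A.card ∣ Nat.lcm B.card C.card)
    (hB : ¬ B.card ∣ Nat.lcm A.card C.card) (hC : ¬ C.card ∣ Nat.lcm A.card B.card) :
    ∃ p q : α, ∀ x' y', x' ≠ y' → ∃ u ∈ H, u p = x' ∧ u q = y' := by
  obtain ⟨a, ha⟩ := h.left.nonempty
  obtain ⟨b, hb⟩ := h.mid.nonempty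
  have hab : a ≠ b := fun hab => Finset.disjoint_left.1 h.left_mid ha (hab ▸ hb)
  obtain ⟨⟨x, y⟩, hxy, hmin⟩ := Set.exists_min_image {w : α × α | w.1 ≠ w.2}
    (fun w => (separators H w.1 w.2).ncard) (Set.toFinite _) ⟨(a, b), hab⟩
  have hA' : (A : Set α) ≠ Set.univ := by
    intro hA
    have : b ∈ (A : Set α) := hA ▸ Set.mem_univ b
    exact Finset.disjoint_left.1 h.left_mid this hb
  obtain ⟨v, hv1, hv2⟩ := MulAction.IsPreprimitive.exists_mem_smul_and_notMem_smul (G := H)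
    A.finite_toSet h.left.nonempty hA' hxy
  rw [Set.mem_smul_set_iff_inv_smul_mem] at hv1 hv2
  have hd : ∀ x' y', x' ≠ y' →
      (separators H (v⁻¹ • x) (v⁻¹ • y)).ncard ≤ (separators H x' y').ncard := by
    intro x' y' hne
    refine le_trans (le_of_eq ?_) (hmin (x', y') hne)
    exact ncard_separators_apply (H.inv_mem v.2) x y
  rcases h.cover (v⁻¹ • y) with h1 | h1 | h1
  · exact absurd h1 hv2
  · refine h.rotate.rotate.exists_pair_map hg ?_ ?_ ?_ hv1 h1 hd
    · rw [← hgcd, ← Nat.gcd_assoc A.card, Nat.gcd_comm]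
    · rwa [Nat.lcm_comm]
    · rwa [Nat.lcm_comm]
  · refine h.swap.exists_pair_map hg ?_ hA ?_ hv1 h1 hd
    · rw [← hgcd, ← Nat.gcd_assoc, ← Nat.gcd_assoc, Nat.gcd_comm B.card]
    · rwa [Nat.lcm_comm]

end PrimitiveNotTwoTransitive

section TwoTransitive

variable {α : Type*}
variable {H : Subgroup (Equiv.Perm α)}

/-- `H` is transitive on ordered pairs of distinct points. -/
def IsTwoTransitive (H : Subgroup (Equiv.Perm α)) : Prop :=
  ∀ x y x' y' : α, x ≠ y → x' ≠ y' → ∃ u ∈ H, u x = x' ∧ u y = y'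

theorem isTwoTransitive_of_exists {p q : α}
    (h : ∀ x y, x ≠ y → ∃ u ∈ H, u p = x ∧ u q = y) : IsTwoTransitive H := by
  intro x y x' y' hxy hxy'
  obtain ⟨u, hu, rfl, rfl⟩ := h x y hxy
  obtain ⟨v, hv, rfl, rfl⟩ := h x' y' hxy'
  exact ⟨v * u⁻¹, H.mul_mem hv (H.inv_mem hu), by simp, by simp⟩

variable [Fintype α] [DecidableEq α]

theorem IsTwoTransitive.card_filter_pair [DecidablePred (· ∈ H)] (hH : IsTwoTransitive H)
    {x y : α} (hxy : x ≠ y) {S : Finset (α × α)} (hS : ∀ w ∈ S, w.1 ≠ w.2) :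
    ((Finset.univ.filter (· ∈ H)).filter (fun h => (h x, h y) ∈ S)).card *
      (Fintype.card α * (Fintype.card α - 1)) =
      (Finset.univ.filter (· ∈ H)).card * S.card := by
  set K := Finset.univ.filter (· ∈ H) with hK
  have hconst : ∀ w : α × α, w.1 ≠ w.2 →
      (K.filter (fun h => (h x, h y) = w)).card =
        (K.filter (fun h => (h x, h y) = (x, y))).card := by
    intro w hw
    obtain ⟨u, hu, h1, h2⟩ := hH x y w.1 w.2 hxy hw
    refine Finset.card_nbij' (fun h => u⁻¹ * h) (fun h => u * h) ?_ ?_ ?_ ?_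
    · intro h hh
      simp only [hK, Finset.coe_filter, Finset.mem_filter, Finset.mem_univ, true_and,
        Set.mem_ofPred_eq] at hh ⊢
      refine ⟨H.mul_mem (H.inv_mem hu) hh.1, ?_⟩
      rw [Prod.ext_iff] at hh
      simp only [Equiv.Perm.mul_apply, Prod.mk.injEq, Equiv.Perm.inv_eq_iff_eq]
      exact ⟨hh.2.1.trans h1.symm, hh.2.2.trans h2.symm⟩
    · intro h hh
      simp only [hK, Finset.coe_filter, Finset.mem_filter, Finset.mem_univ, true_and,
        Set.mem_ofPred_eq, Prod.mk.injEq] at hh ⊢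
      refine ⟨H.mul_mem hu hh.1, ?_⟩
      simp only [Equiv.Perm.mul_apply, hh.2.1, hh.2.2, h1, h2]
    · intro h _
      simp
    · intro h _
      simp
  set c := (K.filter (fun h => (h x, h y) = (x, y))).card with hc
  have hcount : ∀ S : Finset (α × α), (∀ w ∈ S, w.1 ≠ w.2) →
      (K.filter (fun h => (h x, h y) ∈ S)).card = S.card * c := by
    intro S hS
    rw [Finset.card_eq_sum_card_fiberwise (f := fun h : Equiv.Perm α => (h x, h y)) (t := S)]
    · rw [← smul_eq_mul, ← Finset.sum_const]
      refine Finset.sum_congr rfl fun w hw => ?_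
      rw [← hconst w (hS w hw), Finset.filter_filter]
      congr 1
      refine Finset.filter_congr fun h _ => ?_
      constructor
      · exact fun h => h.2
      · exact fun h => ⟨h ▸ hw, h⟩
    · intro h hh
      exact (Finset.mem_filter.1 hh).2
  have htot := hcount (Finset.univ.offDiag) (fun w hw => (Finset.mem_offDiag.1 hw).2.2)
  rw [Finset.filter_true_of_mem (fun h _ => by simpa using hxy), Finset.offDiag_card,
    Finset.card_univ] at htot
  rw [hcount S hS, htot, Nat.mul_sub, mul_one]
  ring

variable [DecidablePred (· ∈ H)]

theorem IsTwoTransitive.card_filter_pair_eq (hH : IsTwoTransitive H)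
    {x y : α} (hxy : x ≠ y) {S : Finset (α × α)} (hS : ∀ w ∈ S, w.1 ≠ w.2) :
    (((Finset.univ.filter (· ∈ H)).filter (fun h => (h x, h y) ∈ S)).card : ℝ) =
      (Finset.univ.filter (· ∈ H)).card * S.card /
        ((Fintype.card α : ℝ) * ((Fintype.card α : ℝ) - 1)) := by
  have hn : 1 < Fintype.card α := Fintype.one_lt_card_iff.2 ⟨x, y, hxy⟩
  have hn' : (1 : ℝ) < Fintype.card α := by exact_mod_cast hn
  have h := hH.card_filter_pair hxy hS
  rw [eq_div_iff (mul_pos (by linarith) (by linarith)).ne', ← Nat.cast_one,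
    ← Nat.cast_sub hn.le]
  exact_mod_cast h

theorem IsTwoTransitive.card_filter_mem_mem (hH : IsTwoTransitive H) (M : Finset α)
    {x y : α} (hxy : x ≠ y) :
    (((Finset.univ.filter (· ∈ H)).filter (fun h => h x ∈ M ∧ h y ∈ M)).card : ℝ) =
      (Finset.univ.filter (· ∈ H)).card * ((M.card : ℝ) * (M.card - 1)) /
        ((Fintype.card α : ℝ) * ((Fintype.card α : ℝ) - 1)) := by
  have h := hH.card_filter_pair_eq hxy (S := M.offDiag) (by
    rintro ⟨a, b⟩ hab
    exact (Finset.mem_offDiag.1 hab).2.2)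
  simp only [Finset.mem_offDiag, ne_eq, EmbeddingLike.apply_eq_iff_eq, hxy, not_false_eq_true,
    and_true, Finset.offDiag_card] at h
  rw [h, Nat.cast_sub (Nat.le_mul_self _)]
  push_cast
  ring

theorem IsTwoTransitive.card_filter_notMem_mem (hH : IsTwoTransitive H) (M : Finset α)
    {x y : α} (hxy : x ≠ y) :
    (((Finset.univ.filter (· ∈ H)).filter (fun h => h x ∉ M ∧ h y ∈ M)).card : ℝ) =
      (Finset.univ.filter (· ∈ H)).card * (((Fintype.card α : ℝ) - M.card) * M.card) /
        ((Fintype.card α : ℝ) * ((Fintype.card α : ℝ) - 1)) := by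
  have h := hH.card_filter_pair_eq hxy (S := Mᶜ ×ˢ M) (by
    intro w hw heq
    rw [Finset.mem_product, Finset.mem_compl] at hw
    exact hw.1 (heq ▸ hw.2))
  simp only [Finset.mem_product, Finset.mem_compl, Finset.card_product, Finset.card_compl] at h
  rw [h, Nat.cast_mul, Nat.cast_sub (Finset.card_le_univ M)]

theorem IsTwoTransitive.card_filter_mem (hH : IsTwoTransitive H) (M : Finset α)
    {x y : α} (hxy : x ≠ y) :
    (((Finset.univ.filter (· ∈ H)).filter (fun h => h x ∈ M)).card : ℝ) =
      (Finset.univ.filter (· ∈ H)).card * M.card / Fintype.card α := by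
  have hn : 1 < Fintype.card α := Fintype.one_lt_card_iff.2 ⟨x, y, hxy⟩
  have hn' : (1 : ℝ) < Fintype.card α := by exact_mod_cast hn
  have h1 := hH.card_filter_mem_mem M hxy
  have h2 := hH.card_filter_notMem_mem M hxy.symm
  have h3 := Finset.card_filter_add_card_filter_not
    (s := (Finset.univ.filter (· ∈ H)).filter (fun h => h x ∈ M)) (fun h => h y ∈ M)
  rw [Finset.filter_filter (fun h : Equiv.Perm α => h x ∈ M) (fun h => h y ∈ M),
    Finset.filter_filter (fun h : Equiv.Perm α => h x ∈ M) (fun h => h y ∉ M)] at h3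
  simp only [and_comm (a := _ ∉ M)] at h2
  rw [← h3, Nat.cast_add, h1, h2]
  have h4 : (Fintype.card α : ℝ) - 1 ≠ 0 := by linarith
  have h5 : (Fintype.card α : ℝ) ≠ 0 := by linarith
  field_simp
  ring

theorem card_filter_eq_sum_indicator {ι : Type*} (s : Finset ι) (p : ι → Prop)
    [DecidablePred p] : ((s.filter p).card : ℝ) = ∑ x ∈ s, if p x then 1 else 0 := by
  rw [Finset.card_filter]
  push_cast
  rfl

theorem IsTwoTransitive.sum_card_inter (hH : IsTwoTransitive H) (M : Finset α)
    (hn : 1 < Fintype.card α) :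
    ∑ h ∈ Finset.univ.filter (· ∈ H), ((M.filter (fun x => h x ∈ M)).card : ℝ) =
      (Finset.univ.filter (· ∈ H)).card * (M.card : ℝ) ^ 2 / Fintype.card α := by
  simp only [card_filter_eq_sum_indicator M]
  rw [Finset.sum_comm]
  simp only [← card_filter_eq_sum_indicator]
  have : Nontrivial α := Fintype.one_lt_card_iff_nontrivial.1 hn
  rw [Finset.sum_congr rfl fun x _ => hH.card_filter_mem M (exists_ne x).choose_spec.symm]
  rw [Finset.sum_const, nsmul_eq_mul]
  ring

theorem IsTwoTransitive.sum_card_inter_sq (hH : IsTwoTransitive H) (M : Finset α)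
    (hn : 1 < Fintype.card α) :
    ∑ h ∈ Finset.univ.filter (· ∈ H), ((M.filter (fun x => h x ∈ M)).card : ℝ) ^ 2 =
      (Finset.univ.filter (· ∈ H)).card * ((M.card : ℝ) ^ 2 / Fintype.card α +
        (M.card : ℝ) ^ 2 * ((M.card : ℝ) - 1) ^ 2 /
          ((Fintype.card α : ℝ) * ((Fintype.card α : ℝ) - 1))) := by
  have : Nontrivial α := Fintype.one_lt_card_iff_nontrivial.1 hn
  have hexp : ∀ h : Equiv.Perm α, ((M.filter (fun x => h x ∈ M)).card : ℝ) ^ 2 =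
      ∑ x ∈ M, ∑ y ∈ M, if h x ∈ M ∧ h y ∈ M then 1 else 0 := by
    intro h
    rw [card_filter_eq_sum_indicator M, sq, Finset.sum_mul_sum]
    refine Finset.sum_congr rfl fun x _ => Finset.sum_congr rfl fun y _ => ?_
    split_ifs <;> simp_all
  simp only [hexp]
  rw [Finset.sum_comm]
  have hinner : ∀ x ∈ M, ∑ h ∈ Finset.univ.filter (· ∈ H), ∑ y ∈ M,
      (if h x ∈ M ∧ h y ∈ M then (1 : ℝ) else 0) =
      (Finset.univ.filter (· ∈ H)).card * (M.card / Fintype.card α +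
        (M.card : ℝ) * ((M.card : ℝ) - 1) ^ 2 /
          ((Fintype.card α : ℝ) * ((Fintype.card α : ℝ) - 1))) := by
    intro x hx
    rw [Finset.sum_comm, ← Finset.add_sum_erase M _ hx]
    simp only [and_self, ← card_filter_eq_sum_indicator]
    rw [hH.card_filter_mem M (exists_ne x).choose_spec.symm, Finset.sum_congr rfl fun y hy =>
      hH.card_filter_mem_mem M (Finset.ne_of_mem_erase hy).symm, Finset.sum_const,
      Finset.card_erase_of_mem hx, nsmul_eq_mul, Nat.cast_sub (Finset.card_pos.2 ⟨x, hx⟩)]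
    push_cast
    ring
  rw [Finset.sum_congr rfl hinner, Finset.sum_const, nsmul_eq_mul]
  ring

theorem IsTwoTransitive.sum_card_crossing (hH : IsTwoTransitive H) (M : Finset α)
    (u : Equiv.Perm α) (hu : ∀ x ∈ M, u x ≠ x) :
    ∑ h ∈ Finset.univ.filter (· ∈ H), ((M.filter (fun x => h x ∉ M ∧ h (u x) ∈ M)).card : ℝ) =
      (Finset.univ.filter (· ∈ H)).card * ((M.card : ℝ) ^ 2 * ((Fintype.card α : ℝ) - M.card)) /
        ((Fintype.card α : ℝ) * ((Fintype.card α : ℝ) - 1)) := by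
  simp only [card_filter_eq_sum_indicator M]
  rw [Finset.sum_comm]
  simp only [← card_filter_eq_sum_indicator]
  rw [Finset.sum_congr rfl fun x hx => hH.card_filter_notMem_mem M (hu x hx).symm]
  rw [Finset.sum_const, nsmul_eq_mul]
  ring

/-- If every element with a crossing moves many points of `M` into `M`, then `M` is large. -/
theorem IsTwoTransitive.card_mul_sq_le (hH : IsTwoTransitive H) (M : Finset α)
    (u : Equiv.Perm α) (hu : ∀ x ∈ M, u x ≠ x) (huM : ∀ x ∈ M, u x ∈ M) (hM : M.Nonempty)
    (hcross : ∀ h ∈ H, (M.filter (fun x => h x ∉ M ∧ h (u x) ∈ M)).Nonempty →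
      M.card ≤ 3 * (M.filter (fun x => h x ∈ M)).card) (hlt : 3 * M.card < Fintype.card α) :
    (M.card : ℝ) * ((Fintype.card α : ℝ) - 3 * M.card) ^ 2 ≤
      3 * Fintype.card α * ((Fintype.card α : ℝ) - M.card) := by
  have hn : 1 < Fintype.card α := by have := hM.card_pos; omega
  have hsum : ∀ h ∈ Finset.univ.filter (· ∈ H),
      3 * (M.card : ℝ) * (1 / 3 - M.card / Fintype.card α) ^ 2 *
        ((M.filter (fun x => h x ∉ M ∧ h (u x) ∈ M)).card : ℝ) ≤
      (((M.filter (fun x => h x ∈ M)).card : ℝ) - (M.card : ℝ) ^ 2 / Fintype.card α) ^ 2 := by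
    intro h hh
    rcases Finset.eq_empty_or_nonempty (M.filter (fun x => h x ∉ M ∧ h (u x) ∈ M)) with h0 | h0
    · rw [h0]
      simp only [Finset.card_empty, Nat.cast_zero, mul_zero]
      positivity
    · have h1 := hcross h (Finset.mem_filter.1 hh).2 h0
      have h2 : (M.filter (fun x => h x ∉ M ∧ h (u x) ∈ M)).card ≤
          (M.filter (fun x => h x ∈ M)).card := by
        refine Finset.card_le_card_of_injOn u ?_ u.injective.injOn
        intro x hx
        simp only [Finset.coe_filter, Set.mem_ofPred_eq] at hx ⊢
        exact ⟨huM x hx.1, hx.2.2⟩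
      generalize (M.filter (fun x => h x ∉ M ∧ h (u x) ∈ M)).card = N at h2
      generalize (M.filter (fun x => h x ∈ M)).card = I at h1 h2
      have h1' : (M.card : ℝ) ≤ 3 * I := by exact_mod_cast h1
      have h2' : (N : ℝ) ≤ I := by exact_mod_cast h2
      have hm : (0 : ℝ) < M.card := by exact_mod_cast hM.card_pos
      have hn' : (0 : ℝ) < Fintype.card α := by exact_mod_cast hn.trans' zero_lt_one
      have hlt' : 3 * (M.card : ℝ) < Fintype.card α := by exact_mod_cast hlt
      obtain ⟨r, hr⟩ : ∃ r : ℝ, r = M.card / Fintype.card α := ⟨_, rfl⟩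
      have hr0 : 0 < r := hr ▸ div_pos hm hn'
      have hr3 : r < 1 / 3 := by
        rw [hr, div_lt_iff₀ hn']
        linarith
      rw [← hr, show (M.card : ℝ) ^ 2 / Fintype.card α = M.card * r by rw [hr]; ring]
      have h3 : 0 ≤ ((I : ℝ) - M.card / 3) * (I - 3 * M.card * r ^ 2) := by
        have h5 : r ^ 2 ≤ 1 / 9 := by nlinarith
        have h6 := mul_le_mul_of_nonneg_left h5 hm.le
        exact mul_nonneg (by linarith) (by linarith)
      have h4 : 3 * (M.card : ℝ) * (1 / 3 - r) ^ 2 * N ≤ 3 * (M.card : ℝ) * (1 / 3 - r) ^ 2 * I :=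
        mul_le_mul_of_nonneg_left h2' (by positivity)
      nlinarith
  have htot := Finset.sum_le_sum hsum
  rw [← Finset.mul_sum, hH.sum_card_crossing M u hu] at htot
  simp only [sub_sq] at htot
  rw [Finset.sum_add_distrib, Finset.sum_sub_distrib, hH.sum_card_inter_sq M hn,
    ← Finset.sum_mul, ← Finset.mul_sum, hH.sum_card_inter M hn, Finset.sum_const,
    nsmul_eq_mul] at htot
  have hK : (0 : ℝ) < (Finset.univ.filter (· ∈ H)).card := by
    exact_mod_cast Finset.card_pos.2 ⟨1, by simp⟩
  have hm : (0 : ℝ) < M.card := by exact_mod_cast hM.card_pos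
  have hn' : (1 : ℝ) < Fintype.card α := by exact_mod_cast hn
  have hlt' : 3 * (M.card : ℝ) < Fintype.card α := by exact_mod_cast hlt
  generalize ((Finset.univ.filter (· ∈ H)).card : ℝ) = K at *
  generalize (M.card : ℝ) = m at *
  generalize (Fintype.card α : ℝ) = n at *
  have hpos : 0 < K * m ^ 2 * (n - m) / (3 * n ^ 3 * (n - 1)) := by
    refine div_pos (mul_pos (by positivity) (by linarith)) (mul_pos (by positivity) (by linarith))
  refine le_of_mul_le_mul_left ?_ hpos
  have hn1 : n - 1 ≠ 0 := by linarith
  have hn0 : n ≠ 0 := by linarith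
  refine le_trans (le_of_eq ?_) (htot.trans (le_of_eq ?_))
  · field_simp
    ring
  · field_simp
    ring

end TwoTransitive

section Classification

variable {α : Type*} [Fintype α] [DecidableEq α] {H : Subgroup (Equiv.Perm α)}

theorem support_commutator_subset (u v : Equiv.Perm α) :
    (u * v * u⁻¹ * v⁻¹).support ⊆ (u.support ∩ v.support) ∪
      ((u.support ∩ v.support).image u ∪ (u.support ∩ v.support).image v) := by
  intro z hz
  have hmem : ∀ f : Equiv.Perm α, ∀ x, f⁻¹ x ∈ f.support ↔ x ∈ f.support := fun f x => by
    simpa using (Equiv.Perm.zpow_apply_mem_support (f := f) (n := -1) (x := x))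
  have hfix : ∀ f : Equiv.Perm α, ∀ x, x ∉ f.support → f⁻¹ x = x := fun f x hx => by
    rw [Equiv.Perm.inv_eq_iff_eq, Equiv.Perm.notMem_support.1 hx]
  have hself : ∀ f : Equiv.Perm α, ∀ x, f (f⁻¹ x) = x := fun f x => by simp
  by_contra hcon
  simp only [Finset.mem_union, Finset.mem_image, Finset.mem_inter, not_or, not_exists,
    not_and] at hcon
  obtain ⟨h1, h2, h3⟩ := hcon
  rw [Equiv.Perm.mem_support] at hz
  apply hz
  simp only [Equiv.Perm.mul_apply]
  by_cases hv : z ∈ v.support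
  · have hu : z ∉ u.support := fun hu => h1 hu hv
    have hvu : v⁻¹ z ∉ u.support := fun h => h3 _ ⟨h, (hmem v z).2 hv⟩ (hself v z)
    rw [hfix u _ hvu, hself, Equiv.Perm.notMem_support.1 hu]
  · rw [hfix v z hv]
    by_cases hu : z ∈ u.support
    · have huv : u⁻¹ z ∉ v.support := fun h => h2 _ ⟨(hmem u z).2 hu, h⟩ (hself u z)
      rw [Equiv.Perm.notMem_support.1 huv, hself]
    · rw [hfix u z hu, Equiv.Perm.notMem_support.1 hv, Equiv.Perm.notMem_support.1 hu]

theorem card_support_le_of_crossing {u h : Equiv.Perm α} (hu : u ∈ H) (hh : h ∈ H)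
    (hmin : ∀ w ∈ H, w ≠ 1 → u.support.card ≤ w.support.card)
    (hne : (u.support.filter (fun x => h x ∉ u.support ∧ h (u x) ∈ u.support)).Nonempty) :
    u.support.card ≤ 3 * (u.support.filter (fun x => h x ∈ u.support)).card := by
  set v := h⁻¹ * u * h with hv
  have hvH : v ∈ H := H.mul_mem (H.mul_mem (H.inv_mem hh) hu) hh
  have hvs : ∀ x, x ∈ v.support ↔ h x ∈ u.support := by
    intro x
    rw [Equiv.Perm.mem_support, Equiv.Perm.mem_support, hv, Equiv.Perm.mul_apply,
      Equiv.Perm.mul_apply, ne_eq, Equiv.Perm.inv_eq_iff_eq]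
  have hinter : u.support.filter (fun x => h x ∈ u.support) = u.support ∩ v.support := by
    ext x
    rw [Finset.mem_filter, Finset.mem_inter, hvs]
  obtain ⟨x, hx⟩ := hne
  rw [Finset.mem_filter, ← hvs, ← hvs] at hx
  have hw : u * v * u⁻¹ * v⁻¹ ≠ 1 := by
    intro hw
    have hcomm : u * v = v * u := by
      rwa [mul_inv_eq_one, mul_inv_eq_iff_eq_mul] at hw
    have h1 : v (u x) = u x := by
      rw [← Equiv.Perm.mul_apply, ← hcomm, Equiv.Perm.mul_apply,
        Equiv.Perm.notMem_support.1 hx.2.1]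
    exact Equiv.Perm.mem_support.1 hx.2.2 h1
  have hwH : u * v * u⁻¹ * v⁻¹ ∈ H :=
    H.mul_mem (H.mul_mem (H.mul_mem hu hvH) (H.inv_mem hu)) (H.inv_mem hvH)
  rw [hinter]
  calc u.support.card ≤ (u * v * u⁻¹ * v⁻¹).support.card := hmin _ hwH hw
    _ ≤ _ := Finset.card_le_card (support_commutator_subset u v)
    _ ≤ (u.support ∩ v.support).card + (((u.support ∩ v.support).image u).card +
        ((u.support ∩ v.support).image v).card) :=
      (Finset.card_union_le _ _).trans (Nat.add_le_add_left (Finset.card_union_le _ _) _)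
    _ ≤ 3 * (u.support ∩ v.support).card := by
      have h1 := Finset.card_image_le (s := u.support ∩ v.support) (f := u)
      have h2 := Finset.card_image_le (s := u.support ∩ v.support) (f := v)
      omega

/-- A form of Bochert's bound for the minimal degree of a doubly transitive group. -/
theorem IsTwoTransitive.exists_minimal_degree [MulAction.IsPreprimitive H α]
    (hH : IsTwoTransitive H) (hA : ¬ alternatingGroup α ≤ H) {w : Equiv.Perm α} (hw : w ∈ H)
    (hw1 : w ≠ 1) :
    ∃ m : ℕ, 4 ≤ m ∧ m ≤ w.support.card ∧ (3 * m < Fintype.card α →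
      (m : ℝ) * ((Fintype.card α : ℝ) - 3 * m) ^ 2 ≤
        3 * Fintype.card α * ((Fintype.card α : ℝ) - m)) := by
  classical
  obtain ⟨u, ⟨huH, hu1⟩, hmin⟩ := Set.exists_min_image {w : Equiv.Perm α | w ∈ H ∧ w ≠ 1}
    (fun w => w.support.card) (Set.toFinite _) ⟨w, hw, hw1⟩
  refine ⟨u.support.card, ?_, hmin w ⟨hw, hw1⟩, fun hlt => ?_⟩
  · have h0 : u.support.card ≠ 0 := by
      rwa [ne_eq, Finset.card_eq_zero, Equiv.Perm.support_eq_empty_iff]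
    have h1 := Equiv.Perm.card_support_ne_one u
    have h2 : u.support.card ≠ 2 := by
      intro h2
      rw [Equiv.Perm.card_support_eq_two] at h2
      apply hA
      rw [Equiv.Perm.subgroup_eq_top_of_isPreprimitive_of_isSwap_mem inferInstance u h2 huH]
      exact le_top
    have h3 : u.support.card ≠ 3 := by
      intro h3
      rw [card_support_eq_three_iff] at h3
      exact hA (Equiv.Perm.alternatingGroup_le_of_isPreprimitive_of_isThreeCycle_mem
        inferInstance h3 huH)
    omega
  · refine hH.card_mul_sq_le u.support u (fun x hx => Equiv.Perm.mem_support.1 hx)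
      (fun x hx => Equiv.Perm.apply_mem_support.2 hx) ?_ ?_ hlt
    · rwa [Finset.nonempty_iff_ne_empty, ne_eq, Equiv.Perm.support_eq_empty_iff]
    · intro h hh hne
      exact card_support_le_of_crossing huH hh (fun w hw hw1 => hmin w ⟨hw, hw1⟩) hne

theorem sq_lt_of_minimal_degree {n a m : ℝ} (hn : 577 ≤ n) (hm4 : 4 ≤ m)
    (hm : m < 7 → m = 4 ∨ m = 5 ∨ m = 6) (hma : m ≤ a) (han : 3 * a ≤ n)
    (h : 3 * m < n → m * (n - 3 * m) ^ 2 ≤ 3 * n * (n - m)) : (n - 3 * a) ^ 2 < 8 * n := by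
  by_contra! hcon
  have hlt : 3 * m < n := by
    by_contra! hge
    have : n - 3 * a = 0 := by linarith
    rw [this] at hcon
    linarith
  have hle := h hlt
  have hsq : 8 * n ≤ (n - 3 * m) ^ 2 := hcon.trans (by gcongr)
  by_cases h7 : m < 7
  · rcases hm h7 with rfl | rfl | rfl <;> nlinarith
  push Not at h7
  have hmono : ∀ t, 0 ≤ t → t ≤ n - 3 * m → ∀ s, 0 ≤ s → s ≤ m →
      s * t ^ 2 ≤ m * (n - 3 * m) ^ 2 := by
    intro t ht htn s hs hsm
    gcongr
  have hn2 : 0 < n ^ 2 := by positivity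
  have hn3 : 577 * n ^ 2 ≤ n ^ 3 := by nlinarith
  by_cases h9 : 9 * m ≤ n
  · have := hmono (2 / 3 * n) (by linarith) (by linarith) 7 (by norm_num) h7
    nlinarith
  by_cases h5 : 5 * m ≤ n
  · have := hmono (2 / 5 * n) (by linarith) (by linarith) (n / 9) (by linarith) (by linarith)
    nlinarith
  by_cases h11 : 11 * m ≤ 3 * n
  · have := hmono (2 / 11 * n) (by linarith) (by linarith) (n / 5) (by linarith) (by linarith)
    nlinarith
  have : m * (8 * n) ≤ m * (n - 3 * m) ^ 2 := by gcongr
  nlinarith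

theorem ThreeCycles.support_pow_lcm {g : Equiv.Perm α} {A B C : Finset α}
    (h : ThreeCycles g A B C) (hA : ¬ A.card ∣ Nat.lcm B.card C.card) :
    (g ^ Nat.lcm B.card C.card).support = A := by
  ext x
  rw [Equiv.Perm.mem_support]
  by_cases hx : x ∈ A
  · simp only [hx, ne_eq, h.left.pow_apply_eq_iff hx, hA, not_false_eq_true]
  · simp only [hx, iff_false, not_not]
    rcases h.cover x with h1 | h1 | h1
    · exact absurd h1 hx
    · exact (h.mid.pow_apply_eq_iff h1 _).2 (Nat.dvd_lcm_left _ _)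
    · exact (h.right.pow_apply_eq_iff h1 _).2 (Nat.dvd_lcm_right _ _)

/-- Triples in which some entry divides the least common multiple of the other two. -/
def IsLcmTriple (T : Multiset ℕ) : Prop :=
  ∃ a b c, T = {a, b, c} ∧ 0 < a ∧ 0 < b ∧ 0 < c ∧ Nat.gcd a (Nat.gcd b c) = 1 ∧ a ∣ Nat.lcm b c

/-- Triples with sum `n` whose smallest entry is close to `n / 3`. -/
def IsBalancedTriple (n : ℕ) (T : Multiset ℕ) : Prop :=
  ∃ a b c, T = {a, b, c} ∧ a ≤ b ∧ b ≤ c ∧ a + b + c = n ∧ (n - 3 * a) ^ 2 < 8 * n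

theorem triple_swap (a b c : ℕ) : ({a, b, c} : Multiset ℕ) = {b, a, c} :=
  Multiset.cons_swap _ _ _

theorem triple_rotate (a b c : ℕ) : ({a, b, c} : Multiset ℕ) = {b, c, a} := by
  simp only [Multiset.insert_eq_cons, ← Multiset.singleton_add]
  abel

theorem IsTwoTransitive.isBalancedTriple [MulAction.IsPreprimitive H α]
    (hH : IsTwoTransitive H) (hAlt : ¬ alternatingGroup α ≤ H) (hn : 577 ≤ Fintype.card α)
    {g : Equiv.Perm α} {A B C : Finset α} (h : ThreeCycles g A B C) (hg : g ∈ H)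
    (hA : ¬ A.card ∣ Nat.lcm B.card C.card) (hAB : A.card ≤ B.card) (hAC : A.card ≤ C.card) :
    IsBalancedTriple (Fintype.card α) {A.card, B.card, C.card} := by
  have hsupp := h.support_pow_lcm hA
  have hne : g ^ Nat.lcm B.card C.card ≠ 1 := by
    rw [ne_eq, ← Equiv.Perm.support_eq_empty_iff, hsupp]
    exact h.left.nonempty.ne_empty
  obtain ⟨m, hm4, hma, hm⟩ := hH.exists_minimal_degree hAlt (H.pow_mem hg _) hne
  rw [hsupp] at hma
  have hsum := h.card_add
  have hsq : (Fintype.card α - 3 * A.card) ^ 2 < 8 * Fintype.card α := by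
    have := sq_lt_of_minimal_degree (n := Fintype.card α) (a := A.card) (m := m)
      (by exact_mod_cast hn) (by exact_mod_cast hm4) (fun h7 => ?_) (by exact_mod_cast hma)
      (by norm_cast; omega) (fun h3 => hm (by exact_mod_cast h3))
    · have hcast : ((Fintype.card α - 3 * A.card : ℕ) : ℝ) = Fintype.card α - 3 * A.card := by
        rw [Nat.cast_sub (by omega)]
        push_cast
        rfl
      rw [← hcast] at this
      exact_mod_cast this
    · have h7' : m < 7 := by exact_mod_cast h7
      norm_cast
      omega
  rcases le_total B.card C.card with hBC | hBC
  · exact ⟨_, _, _, rfl, hAB, hBC, hsum, hsq⟩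
  · refine ⟨A.card, C.card, B.card, ?_, hAC, hBC, by omega, hsq⟩
    rw [triple_rotate, triple_swap]
    exact (triple_rotate _ _ _).symm

theorem IsTwoTransitive.isBalancedTriple_of_not_dvd [MulAction.IsPreprimitive H α]
    (hH : IsTwoTransitive H) (hAlt : ¬ alternatingGroup α ≤ H) (hn : 577 ≤ Fintype.card α)
    {g : Equiv.Perm α} {A B C : Finset α} (h : ThreeCycles g A B C) (hg : g ∈ H)
    (hA : ¬ A.card ∣ Nat.lcm B.card C.card) (hB : ¬ B.card ∣ Nat.lcm A.card C.card)
    (hC : ¬ C.card ∣ Nat.lcm A.card B.card) :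
    IsBalancedTriple (Fintype.card α) {A.card, B.card, C.card} := by
  by_cases h1 : A.card ≤ B.card ∧ A.card ≤ C.card
  · exact hH.isBalancedTriple hAlt hn h hg hA h1.1 h1.2
  by_cases h2 : B.card ≤ A.card ∧ B.card ≤ C.card
  · rw [triple_swap]
    exact hH.isBalancedTriple hAlt hn h.swap hg hB h2.1 h2.2
  · rw [← triple_rotate]
    exact hH.isBalancedTriple hAlt hn h.rotate.rotate hg hC (by omega) (by omega)

theorem exists_card_mem_or_forall_triple (hAlt : ¬ alternatingGroup α ≤ H)
    (hn : 577 ≤ Fintype.card α) :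
    (∃ k, 1 ≤ k ∧ 2 * k ≤ Fintype.card α ∧ ∀ g ∈ H, ∀ A B C, ThreeCycles g A B C →
      k ∈ ({A.card, B.card, C.card} : Multiset ℕ) ∨
        Fintype.card α - k ∈ ({A.card, B.card, C.card} : Multiset ℕ)) ∨
    ∀ g ∈ H, ∀ A B C, ThreeCycles g A B C → Nat.gcd A.card (Nat.gcd B.card C.card) = 1 →
      IsImprimitiveTriple (Fintype.card α) {A.card, B.card, C.card} ∨
      IsLcmTriple {A.card, B.card, C.card} ∨
      IsBalancedTriple (Fintype.card α) {A.card, B.card, C.card} := by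
  by_cases hT : MulAction.IsPretransitive H α
  swap
  · exact Or.inl (exists_card_mem_of_not_isPretransitive H hT)
  right
  intro g hg A B C h hgcd
  by_cases hP : MulAction.IsPreprimitive H α
  swap
  · exact Or.inl (isImprimitiveTriple_of_not_isPreprimitive H hP hg h hgcd)
  right
  have hA0 := Finset.card_pos.2 h.left.nonempty
  have hB0 := Finset.card_pos.2 h.mid.nonempty
  have hC0 := Finset.card_pos.2 h.right.nonempty
  by_cases hA : A.card ∣ Nat.lcm B.card C.card
  · exact Or.inl ⟨_, _, _, rfl, hA0, hB0, hC0, hgcd, hA⟩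
  by_cases hB : B.card ∣ Nat.lcm A.card C.card
  · refine Or.inl ⟨_, _, _, triple_swap _ _ _, hB0, hA0, hC0, ?_, hB⟩
    rw [← hgcd, ← Nat.gcd_assoc, ← Nat.gcd_assoc, Nat.gcd_comm B.card]
  by_cases hC : C.card ∣ Nat.lcm A.card B.card
  · refine Or.inl ⟨C.card, A.card, B.card, (triple_rotate _ _ _).symm, hC0, hA0, hB0, ?_, hC⟩
    rw [← hgcd, ← Nat.gcd_assoc A.card, Nat.gcd_comm]
  right
  obtain ⟨p, q, hpq⟩ := h.isTwoTransitive hg hgcd hA hB hC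
  exact (isTwoTransitive_of_exists hpq).isBalancedTriple_of_not_dvd hAlt hn h hg hA hB hC

end Classification

section CoprimeTriples

theorem card_filter_forall_dvd {n : ℕ} {S : Finset ℕ} (hS : S ⊆ n.primeFactors) :
    (((Finset.Ioc 0 n).filter (fun a => ∀ p ∈ S, p ∣ a)).card : ℝ) = n / ∏ p ∈ S, (p : ℝ) := by
  have hprime : ∀ p ∈ S, Prime p := fun p hp => (Nat.prime_of_mem_primeFactors (hS hp)).prime
  have hdvd : ∀ a, (∀ p ∈ S, p ∣ a) ↔ (∏ p ∈ S, p) ∣ a := fun a =>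
    ⟨fun h => Finset.prod_primes_dvd a hprime h, fun h p hp =>
      (Finset.dvd_prod_of_mem _ hp).trans h⟩
  simp only [hdvd]
  rw [Nat.Ioc_filter_dvd_card_eq_div, Nat.cast_div, Nat.cast_prod]
  · exact (hdvd n).1 fun p hp => Nat.dvd_of_mem_primeFactors (hS hp)
  · exact_mod_cast Finset.prod_ne_zero_iff.2 fun p hp => (hprime p hp).ne_zero

theorem gcd_eq_one_iff_forall_primeFactors {a b n : ℕ} (hn : n ≠ 0) :
    Nat.gcd a (Nat.gcd b n) = 1 ↔ ∀ p ∈ n.primeFactors, ¬ (p ∣ a ∧ p ∣ b) := by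
  constructor
  · intro h p hp hab
    have h1 := Nat.dvd_gcd hab.1 (Nat.dvd_gcd hab.2 (Nat.dvd_of_mem_primeFactors hp))
    rw [h] at h1
    exact (Nat.prime_of_mem_primeFactors hp).one_lt.ne' (Nat.dvd_one.1 h1)
  · intro h
    by_contra hne
    obtain ⟨p, hp, hdvd⟩ := Nat.exists_prime_and_dvd hne
    rw [Nat.dvd_gcd_iff, Nat.dvd_gcd_iff] at hdvd
    exact h p (Nat.mem_primeFactors.2 ⟨hp, hdvd.2.2, hn⟩) ⟨hdvd.1, hdvd.2.1⟩

/-- The value at `n` of the second Jordan totient function. -/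
theorem card_filter_gcd_eq_one {n : ℕ} (hn : n ≠ 0) :
    (((Finset.Ioc 0 n ×ˢ Finset.Ioc 0 n).filter
      (fun w => Nat.gcd w.1 (Nat.gcd w.2 n) = 1)).card : ℝ) =
      (n : ℝ) ^ 2 * ∏ p ∈ n.primeFactors, (1 - 1 / (p : ℝ) ^ 2) := by
  have hind : ∀ w : ℕ × ℕ, (if Nat.gcd w.1 (Nat.gcd w.2 n) = 1 then (1 : ℝ) else 0) =
      ∑ S ∈ n.primeFactors.powerset, (-1) ^ S.card *
        ((if ∀ p ∈ S, p ∣ w.1 then (1 : ℝ) else 0) *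
          (if ∀ p ∈ S, p ∣ w.2 then (1 : ℝ) else 0)) := by
    intro w
    have h1 : (if Nat.gcd w.1 (Nat.gcd w.2 n) = 1 then (1 : ℝ) else 0) =
        ∏ p ∈ n.primeFactors, ((-if p ∣ w.1 ∧ p ∣ w.2 then (1 : ℝ) else 0) + 1) := by
      split_ifs with h
      · rw [gcd_eq_one_iff_forall_primeFactors hn] at h
        rw [Finset.prod_congr rfl (g := fun _ => (1 : ℝ)) fun p hp => by simp [h p hp],
          Finset.prod_const_one]
      · rw [gcd_eq_one_iff_forall_primeFactors hn] at h
        push Not at h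
        obtain ⟨p, hp, hab⟩ := h
        rw [Finset.prod_eq_zero hp]
        simp [hab]
    rw [h1, Finset.prod_add]
    refine Finset.sum_congr rfl fun S _ => ?_
    rw [Finset.prod_const_one, mul_one, Finset.prod_neg]
    congr 1
    rw [Finset.prod_ite_zero, Finset.prod_const_one]
    simp only [forall₂_and]
    split_ifs <;> simp_all
  rw [Finset.card_filter]
  push_cast
  simp only [hind]
  rw [Finset.sum_comm]
  have hterm : ∀ S ∈ n.primeFactors.powerset,
      ∑ w ∈ Finset.Ioc 0 n ×ˢ Finset.Ioc 0 n, (-1) ^ S.card *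
        ((if ∀ p ∈ S, p ∣ w.1 then (1 : ℝ) else 0) * (if ∀ p ∈ S, p ∣ w.2 then (1 : ℝ) else 0)) =
      (n : ℝ) ^ 2 * ∏ p ∈ S, (-(1 / (p : ℝ) ^ 2)) := by
    intro S hS
    rw [← Finset.mul_sum, Finset.sum_product' (f := fun a b =>
      (if ∀ p ∈ S, p ∣ a then (1 : ℝ) else 0) * (if ∀ p ∈ S, p ∣ b then (1 : ℝ) else 0)),
      ← Finset.sum_mul_sum, ← card_filter_eq_sum_indicator,
      card_filter_forall_dvd (Finset.mem_powerset.1 hS), Finset.prod_neg, Finset.prod_div_distrib,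
      Finset.prod_pow, Finset.prod_const_one]
    ring
  rw [Finset.sum_congr rfl hterm, ← Finset.mul_sum]
  congr 1
  simp only [sub_eq_neg_add]
  rw [Finset.prod_add]
  simp

/-- Ordered coprime triples with sum `n`, recorded by their first two entries. -/
def coprimePairs (n : ℕ) : Finset (ℕ × ℕ) :=
  (Finset.Ioc 0 n ×ˢ Finset.Ioc 0 n).filter
    (fun w => w.1 + w.2 < n ∧ Nat.gcd w.1 (Nat.gcd w.2 n) = 1)

/-- Unordered coprime triples of positive integers with sum `n`. -/
def coprimeTriples (n : ℕ) : Finset (Multiset ℕ) :=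
  (coprimePairs n).image (fun w => {w.1, w.2, n - w.1 - w.2})

theorem gcd_sub_eq {a b n : ℕ} (ha : a ≤ n) (hb : b ≤ n) :
    Nat.gcd (n - a) (Nat.gcd (n - b) n) = Nat.gcd a (Nat.gcd b n) := by
  rw [Nat.gcd_self_sub_left hb, Nat.gcd_comm b, ← Nat.gcd_assoc, ← Nat.gcd_assoc,
    Nat.gcd_self_sub_left ha]

theorem card_filter_gcd_le (n : ℕ) :
    ((Finset.Ioc 0 n ×ˢ Finset.Ioc 0 n).filter
      (fun w => Nat.gcd w.1 (Nat.gcd w.2 n) = 1)).card ≤ 2 * (coprimePairs n).card + 3 * n := by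
  have hsub : (Finset.Ioc 0 n ×ˢ Finset.Ioc 0 n).filter
      (fun w => Nat.gcd w.1 (Nat.gcd w.2 n) = 1) ⊆
      (coprimePairs n ∪ (coprimePairs n).image (fun w => (n - w.1, n - w.2))) ∪
      ((Finset.Ioc 0 n).image (fun a => (a, n)) ∪ ((Finset.Ioc 0 n).image (fun a => (n, a)) ∪
        (Finset.Ioc 0 n).image (fun a => (a, n - a)))) := by
    rintro ⟨a, b⟩ h
    simp only [Finset.mem_filter, Finset.mem_product, Finset.mem_Ioc] at h
    simp only [coprimePairs, Finset.mem_union, Finset.mem_image, Finset.mem_filter,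
      Finset.mem_product, Finset.mem_Ioc, Prod.exists, Prod.mk.injEq]
    obtain ⟨⟨⟨ha, han⟩, hb, hbn⟩, hgcd⟩ := h
    rcases eq_or_lt_of_le hbn with rfl | hbn'
    · exact Or.inr (Or.inl ⟨a, ⟨ha, han⟩, rfl, rfl⟩)
    rcases eq_or_lt_of_le han with rfl | han'
    · exact Or.inr (Or.inr (Or.inl ⟨b, ⟨hb, hbn⟩, rfl, rfl⟩))
    rcases lt_trichotomy (a + b) n with hlt | heq | hgt
    · exact Or.inl (Or.inl ⟨⟨⟨ha, han⟩, hb, hbn⟩, hlt, hgcd⟩)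
    · exact Or.inr (Or.inr (Or.inr ⟨a, ⟨ha, han⟩, rfl, by omega⟩))
    · refine Or.inl (Or.inr ⟨n - a, n - b, ⟨⟨⟨by omega, by omega⟩, by omega, by omega⟩, by omega,
        ?_⟩, by omega, by omega⟩)
      rwa [gcd_sub_eq han hbn]
  refine (Finset.card_le_card hsub).trans ?_
  refine (Finset.card_union_le _ _).trans ?_
  have h1 := Finset.card_union_le (coprimePairs n)
    ((coprimePairs n).image fun w => (n - w.1, n - w.2))
  have h2 := Finset.card_image_le (s := coprimePairs n) (f := fun w => (n - w.1, n - w.2))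
  have h3 : ∀ f : ℕ → ℕ × ℕ, ((Finset.Ioc 0 n).image f).card ≤ n := fun f =>
    Finset.card_image_le.trans (by simp)
  have h4 := Finset.card_union_le ((Finset.Ioc 0 n).image (fun a => (a, n)))
    ((Finset.Ioc 0 n).image (fun a => (n, a)) ∪ (Finset.Ioc 0 n).image (fun a => (a, n - a)))
  have h5 := Finset.card_union_le ((Finset.Ioc 0 n).image (fun a => (n, a)))
    ((Finset.Ioc 0 n).image (fun a => (a, n - a)))
  have h6 := h3 (fun a => (a, n))
  have h7 := h3 (fun a => (n, a))
  have h8 := h3 (fun a => (a, n - a))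
  omega

theorem eq_of_triple_eq {a b c x y z : ℕ} (h : ({a, b, c} : Multiset ℕ) = {x, y, z}) :
    (a, b) ∈ ({(x, y), (x, z), (y, x), (y, z), (z, x), (z, y)} : Finset (ℕ × ℕ)) := by
  have hpair : ∀ {b c y z : ℕ}, ({b, c} : Multiset ℕ) = {y, z} → b = y ∨ b = z := by
    intro b c y z h
    have : b ∈ ({y, z} : Multiset ℕ) := h ▸ by simp
    simpa using this
  have ha : a ∈ ({x, y, z} : Multiset ℕ) := h ▸ by simp
  simp only [Multiset.insert_eq_cons, Multiset.mem_cons, Multiset.mem_singleton] at ha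
  simp only [Finset.mem_insert, Finset.mem_singleton, Prod.mk.injEq]
  rcases ha with rfl | rfl | rfl
  · have := hpair ((Multiset.cons_inj_right _).1 h)
    tauto
  · rw [triple_swap x] at h
    have := hpair ((Multiset.cons_inj_right _).1 h)
    tauto
  · rw [← triple_rotate a x] at h
    have := hpair ((Multiset.cons_inj_right _).1 h)
    tauto

theorem card_coprimePairs_le (n : ℕ) : (coprimePairs n).card ≤ 6 * (coprimeTriples n).card := by
  refine Finset.card_le_mul_card_image _ _ fun T hT => ?_
  obtain ⟨⟨x, y⟩, -, rfl⟩ := Finset.mem_image.1 hT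
  refine le_trans (Finset.card_le_card (t := {(x, y), (x, n - x - y), (y, x), (y, n - x - y),
    (n - x - y, x), (n - x - y, y)}) ?_) Finset.card_le_six
  rintro ⟨a, b⟩ hab
  exact eq_of_triple_eq (Finset.mem_filter.1 hab).2

theorem sq_mul_zeta2_le {n : ℕ} (hn : n ≠ 0) :
    (n : ℝ) ^ 2 * zeta2 n ≤ (coprimeTriples n).card + n / 4 := by
  have h1 := card_filter_gcd_eq_one hn
  have h2 : ((((Finset.Ioc 0 n ×ˢ Finset.Ioc 0 n).filter
      (fun w => Nat.gcd w.1 (Nat.gcd w.2 n) = 1)).card : ℕ) : ℝ) ≤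
      2 * (coprimePairs n).card + 3 * n := by exact_mod_cast card_filter_gcd_le n
  have h3 : ((coprimePairs n).card : ℝ) ≤ 6 * (coprimeTriples n).card := by
    exact_mod_cast card_coprimePairs_le n
  rw [h1] at h2
  rw [zeta2]
  linarith

end CoprimeTriples

section Covered

/-- Triples with sum `n` having `k` or `n - k` as an entry. -/
def triplesThrough (n k : ℕ) : Finset (Multiset ℕ) :=
  (Finset.Icc 1 ((n - k) / 2)).image (fun d => {k, d, n - k - d}) ∪
    (Finset.Icc 1 (k / 2)).image (fun d => {n - k, d, k - d})

theorem pair_swap (a b : ℕ) : ({a, b} : Multiset ℕ) = {b, a} :=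
  Multiset.pair_comm a b

theorem mem_triplesThrough_of_add {n k b c : ℕ} (hb : 0 < b) (hc : 0 < c) (h : k + b + c = n) :
    ({k, b, c} : Multiset ℕ) ∈ triplesThrough n k := by
  refine Finset.mem_union_left _ (Finset.mem_image.2 ?_)
  rcases le_total b c with hbc | hbc
  · exact ⟨b, Finset.mem_Icc.2 ⟨hb, by omega⟩, by rw [show n - k - b = c by omega]⟩
  · refine ⟨c, Finset.mem_Icc.2 ⟨hc, by omega⟩, ?_⟩
    rw [show n - k - c = b by omega]
    exact congrArg _ (pair_swap c b)

theorem mem_triplesThrough_of_add' {n k b c : ℕ} (hb : 0 < b) (hc : 0 < c) (h : b + c = k) :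
    ({n - k, b, c} : Multiset ℕ) ∈ triplesThrough n k := by
  refine Finset.mem_union_right _ (Finset.mem_image.2 ?_)
  rcases le_total b c with hbc | hbc
  · exact ⟨b, Finset.mem_Icc.2 ⟨hb, by omega⟩, by rw [show k - b = c by omega]⟩
  · refine ⟨c, Finset.mem_Icc.2 ⟨hc, by omega⟩, ?_⟩
    rw [show k - c = b by omega]
    exact congrArg _ (pair_swap c b)

theorem mem_triplesThrough {n k a b c : ℕ} (ha : 0 < a) (hb : 0 < b) (hc : 0 < c)
    (h : a + b + c = n) (hk : k ∈ ({a, b, c} : Multiset ℕ) ∨ n - k ∈ ({a, b, c} : Multiset ℕ))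
    (hkn : k ≤ n) : ({a, b, c} : Multiset ℕ) ∈ triplesThrough n k := by
  simp only [Multiset.insert_eq_cons, Multiset.mem_cons, Multiset.mem_singleton] at hk
  rcases hk with (rfl | rfl | rfl) | (hk | hk | hk)
  · exact mem_triplesThrough_of_add hb hc h
  · rw [triple_swap]
    exact mem_triplesThrough_of_add ha hc (by omega)
  · rw [← triple_rotate]
    exact mem_triplesThrough_of_add ha hb (by omega)
  · rw [← hk]
    exact mem_triplesThrough_of_add' hb hc (by omega)
  · rw [triple_swap, ← hk]
    exact mem_triplesThrough_of_add' ha hc (by omega)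
  · rw [← triple_rotate, ← hk]
    exact mem_triplesThrough_of_add' ha hb (by omega)

theorem card_triplesThrough_le {n k : ℕ} (hk : k ≤ n) : 2 * (triplesThrough n k).card ≤ n := by
  have h := Finset.card_union_le
    ((Finset.Icc 1 ((n - k) / 2)).image (fun d => ({k, d, n - k - d} : Multiset ℕ)))
    ((Finset.Icc 1 (k / 2)).image (fun d => {n - k, d, k - d}))
  have h1 := Finset.card_image_le (s := Finset.Icc 1 ((n - k) / 2))
    (f := fun d => ({k, d, n - k - d} : Multiset ℕ))
  have h2 := Finset.card_image_le (s := Finset.Icc 1 (k / 2))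
    (f := fun d => ({n - k, d, k - d} : Multiset ℕ))
  rw [Nat.card_Icc] at h1 h2
  rw [triplesThrough]
  omega

theorem triple_injOn {n k : ℕ} (hk : 0 < k) {x y : ℕ} (hx : k < x) (hy : k < y)
    (hxn : 2 * x ≤ n) (hyn : 2 * y ≤ n)
    (h : ({k, x - k, n - x} : Multiset ℕ) = {k, y - k, n - y}) : x = y := by
  have h' := (Multiset.cons_inj_right _).1 h
  have hmem : x - k ∈ ({y - k, n - y} : Multiset ℕ) := h' ▸ by simp
  simp only [Multiset.insert_eq_cons, Multiset.mem_cons, Multiset.mem_singleton] at hmem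
  omega

/-- The number of triples having `k` or `n - k` as an entry for some `k ∈ S`. -/
theorem card_biUnion_triplesThrough_le {n : ℕ} (S : Finset ℕ)
    (hS : ∀ k ∈ S, 1 ≤ k ∧ 2 * k ≤ n) :
    2 * (S.biUnion (triplesThrough n)).card + S.card ^ 2 ≤ S.card * (n + 1) := by
  induction S using Finset.induction_on_min with
  | empty => simp
  | insert k S hlt ih =>
    have hkS : k ∉ S := fun h => lt_irrefl _ (hlt k h)
    have ih' := ih fun x hx => hS x (Finset.mem_insert_of_mem hx)
    obtain ⟨hk1, hkn⟩ := hS k (Finset.mem_insert_self _ _)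
    set U := S.biUnion (triplesThrough n) with hU
    have hinj : S.card ≤ (triplesThrough n k ∩ U).card := by
      refine Finset.card_le_card_of_injOn (fun x => {k, x - k, n - x}) ?_ ?_
      · intro x hx
        have hx' : x ∈ S := hx
        have hkx := hlt x hx'
        have hxn := (hS x (Finset.mem_insert_of_mem hx')).2
        refine Finset.mem_coe.2 (Finset.mem_inter.2 ⟨?_, Finset.mem_biUnion.2 ⟨x, hx', ?_⟩⟩)
        · exact mem_triplesThrough_of_add (by omega) (by omega) (by omega)
        · exact mem_triplesThrough (by omega) (by omega) (by omega) (by omega)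
            (Or.inr (by simp)) (by omega)
      · intro x hx y hy hxy
        exact triple_injOn hk1 (hlt x hx) (hlt y hy) (hS x (Finset.mem_insert_of_mem hx)).2
          (hS y (Finset.mem_insert_of_mem hy)).2 hxy
    have hcard := Finset.card_union_add_card_inter (triplesThrough n k) U
    have hk := card_triplesThrough_le (n := n) (k := k) (by omega)
    rw [Finset.biUnion_insert, Finset.card_insert_of_notMem hkS]
    nlinarith

end Covered

section Counting

open Finset in
theorem exists_imprimitive_finset (n : ℕ) :
    ∃ F : Finset (Multiset ℕ), (∀ T, IsImprimitiveTriple n T → T ∈ F) ∧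
      2 * F.card ≤ (n.divisors.filter (fun m => 1 < m ∧ m < n)).card * n := by
  refine ⟨(n.divisors.filter (fun m => 1 < m ∧ m < n)).biUnion fun m =>
    (Icc 1 (n / m - 1) ×ˢ Icc 1 (m / 2)).image
      (fun w => {w.1 * w.2, w.1 * (m - w.2), n - w.1 * m}), ?_, ?_⟩
  · rintro T ⟨m, l, x, hdvd, hm1, hmn, hl, hlm, hx, hxm, rfl⟩
    refine mem_biUnion.2 ⟨m, mem_filter.2 ⟨Nat.mem_divisors.2 ⟨hdvd, by omega⟩, hm1, hmn⟩,
      mem_image.2 ⟨(l, x), mem_product.2 ⟨mem_Icc.2 ⟨hl, ?_⟩, mem_Icc.2 ⟨hx, by omega⟩⟩, rfl⟩⟩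
    obtain ⟨e, rfl⟩ := hdvd
    rw [Nat.mul_div_cancel_left _ (by omega)]
    have : l < e := by
      rw [mul_comm] at hlm
      exact lt_of_mul_lt_mul_left hlm (Nat.zero_le _)
    omega
  · refine (Nat.mul_le_mul_left 2 (card_biUnion_le_card_mul _ _ (n / 2) fun m hm => ?_)).trans ?_
    · refine card_image_le.trans ?_
      rw [card_product, Nat.card_Icc, Nat.card_Icc, Nat.add_sub_cancel, Nat.add_sub_cancel,
        Nat.le_div_iff_mul_le two_pos, mul_assoc]
      calc (n / m - 1) * (m / 2 * 2) ≤ (n / m) * m :=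
            Nat.mul_le_mul (Nat.sub_le _ _) (Nat.div_mul_le_self _ _)
        _ ≤ n := Nat.div_mul_le_self _ _
    · rw [mul_left_comm]
      exact Nat.mul_le_mul_left _ (Nat.mul_div_le _ _)

theorem card_proper_divisors_le (n : ℕ) :
    (n.divisors.filter (fun m => 1 < m ∧ m < n)).card ≤
      2 * (n.divisors.filter (fun m => 1 < m ∧ m ≤ n.sqrt)).card := by
  have hsub : n.divisors.filter (fun m => 1 < m ∧ m < n) ⊆
      n.divisors.filter (fun m => 1 < m ∧ m ≤ n.sqrt) ∪
        (n.divisors.filter (fun m => 1 < m ∧ m ≤ n.sqrt)).image (fun m => n / m) := by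
    intro m hm
    simp only [Finset.mem_filter, Nat.mem_divisors, Finset.mem_union, Finset.mem_image] at hm ⊢
    obtain ⟨⟨hdvd, hn⟩, hm1, hmn⟩ := hm
    obtain ⟨e, rfl⟩ := hdvd
    by_cases hs : m ≤ (m * e).sqrt
    · exact Or.inl ⟨⟨Dvd.intro _ rfl, hn⟩, hm1, hs⟩
    · refine Or.inr ⟨e, ⟨⟨Dvd.intro_left _ rfl, hn⟩, ?_, ?_⟩, ?_⟩
      · by_contra! he
        interval_cases e <;> simp_all
      · by_contra! he
        have h1 : (m * e).sqrt + 1 ≤ m := by omega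
        have h2 : (m * e).sqrt + 1 ≤ e := by omega
        exact absurd (Nat.mul_le_mul h1 h2) (not_le.2 (Nat.lt_succ_sqrt _))
      · exact Nat.mul_div_cancel _ (by
          rcases Nat.eq_zero_or_pos e with rfl | he
          · simp at hn
          · exact he)
  refine (Finset.card_le_card hsub).trans ((Finset.card_union_le _ _).trans ?_)
  have := Finset.card_image_le (s := n.divisors.filter (fun m => 1 < m ∧ m ≤ n.sqrt))
    (f := fun m => n / m)
  omega

theorem card_small_divisors_le (n : ℕ) :
    (n.divisors.filter (fun m => 1 < m ∧ m ≤ n.sqrt)).card ≤ n.sqrt - 1 := by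
  have hsub : n.divisors.filter (fun m => 1 < m ∧ m ≤ n.sqrt) ⊆ Finset.Ioc 1 n.sqrt := by
    intro m hm
    exact Finset.mem_Ioc.2 (Finset.mem_filter.1 hm).2
  simpa using Finset.card_le_card hsub

theorem card_small_divisors_le_of_odd {n : ℕ} (hn : Odd n) :
    2 * (n.divisors.filter (fun m => 1 < m ∧ m ≤ n.sqrt)).card ≤ n.sqrt - 1 := by
  have h : (n.divisors.filter (fun m => 1 < m ∧ m ≤ n.sqrt)).card ≤
      (Finset.Icc 1 ((n.sqrt - 1) / 2)).card := by
    refine Finset.card_le_card_of_injOn (fun m => m / 2) ?_ ?_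
    · intro m hm
      simp only [Finset.coe_filter, Nat.mem_divisors, Set.mem_ofPred_eq] at hm
      obtain ⟨k, rfl⟩ := hn.of_dvd_nat hm.1.1
      simp only [Finset.coe_Icc, Set.mem_Icc]
      omega
    · intro a ha b hb hab
      simp only [Finset.coe_filter, Nat.mem_divisors, Set.mem_ofPred_eq] at ha hb
      obtain ⟨k, rfl⟩ := hn.of_dvd_nat ha.1.1
      obtain ⟨l, rfl⟩ := hn.of_dvd_nat hb.1.1
      simp only at hab
      omega
  rw [Nat.card_Icc] at h
  omega

theorem exists_balanced_finset (n : ℕ) :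
    ∃ F : Finset (Multiset ℕ), (∀ T, IsBalancedTriple n T → T ∈ F) ∧
      F.card ≤ ((8 * n).sqrt / 3 + 1) * ((8 * n).sqrt / 2 + 1) := by
  refine ⟨(Finset.range ((8 * n).sqrt / 3 + 1) ×ˢ Finset.range ((8 * n).sqrt / 2 + 1)).image
    (fun w => {(n - (3 * w.1 + n % 3)) / 3, (n - (3 * w.1 + n % 3)) / 3 + w.2,
      n - (2 * ((n - (3 * w.1 + n % 3)) / 3) + w.2)}), ?_, ?_⟩
  · rintro T ⟨a, b, c, rfl, hab, hbc, hsum, hsq⟩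
    have hle : n - 3 * a ≤ (8 * n).sqrt := by
      rw [Nat.le_sqrt', sq] at *
      exact hsq.le
    refine Finset.mem_image.2 ⟨((n - 3 * a) / 3, b - a), ?_, ?_⟩
    · rw [Finset.mem_product, Finset.mem_range, Finset.mem_range]
      dsimp only
      omega
    · have h1 : (n - (3 * ((n - 3 * a) / 3) + n % 3)) / 3 = a := by omega
      simp only [h1]
      rw [show a + (b - a) = b by omega, show n - (2 * a + (b - a)) = c by omega]
  · refine Finset.card_image_le.trans ?_
    rw [Finset.card_product, Finset.card_range, Finset.card_range]

theorem sum_sum_div_le_harmonic_sq (N : ℕ) :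
    ∑ y ∈ Finset.range N, ∑ x ∈ Finset.range y, 1 / (((x : ℝ) + 1) * ((y : ℝ) + 1)) ≤
      (harmonic N : ℝ) ^ 2 / 2 := by
  induction N with
  | zero => simp
  | succ N ih =>
    have hin : ∑ x ∈ Finset.range N, 1 / (((x : ℝ) + 1) * ((N : ℝ) + 1)) =
        (harmonic N : ℝ) / ((N : ℝ) + 1) := by
      rw [harmonic, Rat.cast_sum, Finset.sum_div]
      refine Finset.sum_congr rfl fun x _ => ?_
      push_cast
      rw [one_div, mul_inv, div_eq_mul_inv]
    rw [Finset.sum_range_succ, hin, harmonic_succ]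
    push_cast
    have : (0 : ℝ) ≤ ((N : ℝ) + 1)⁻¹ ^ 2 := sq_nonneg _
    rw [div_eq_mul_inv (harmonic N : ℝ)]
    nlinarith

theorem harmonic_le_log_add {n : ℕ} (hn : 6 ≤ n) : (harmonic n : ℝ) ≤ Real.log n + 2 / 3 := by
  have h := (Real.strictAnti_eulerMascheroniSeq'.antitone hn).trans
    Real.eulerMascheroniSeq'_six_lt_two_thirds.le
  rw [Real.eulerMascheroniSeq', if_neg (by omega)] at h
  linarith

theorem exists_mul_dvd_of_dvd_lcm {a b c : ℕ} (hb : b ≠ 0) (hc : c ≠ 0) (h : a ∣ Nat.lcm b c) :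
    ∃ x y, a = x * y ∧ Nat.Coprime x y ∧ x ∣ b ∧ y ∣ c := by
  have hcop : (b.factorizationLCMLeft c).Coprime (b.factorizationLCMRight c) :=
    Nat.coprime_factorizationLCMLeft_factorizationLCMRight b c
  refine ⟨a.gcd (b.factorizationLCMLeft c), a.gcd (b.factorizationLCMRight c), ?_, ?_, ?_, ?_⟩
  · rw [← hcop.gcd_mul,
      Nat.factorizationLCMLeft_mul_factorizationLCMRight hb hc, Nat.gcd_eq_left h]
  · exact (hcop.coprime_dvd_left (Nat.gcd_dvd_right _ _)).coprime_dvd_right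
      (Nat.gcd_dvd_right _ _)
  · exact (Nat.gcd_dvd_right _ _).trans (Nat.factorizationLCMLeft_dvd_left b c)
  · exact (Nat.gcd_dvd_right _ _).trans (Nat.factorizationLCMRight_dvd_right b c)

/-- The triples `{x * y, x * b, n - x * y - x * b}` with `b` in a fixed class modulo `y`. -/
theorem exists_finset_progression (n x y : ℕ) :
    ∃ F : Finset (Multiset ℕ), F.card ≤ n / (x * y) ∧
      ∀ b, 0 < x → 0 < y → 0 < b → Nat.Coprime x y → x * y + x * b < n →
        y ∣ n - x * y - x * b → ({x * y, x * b, n - x * y - x * b} : Multiset ℕ) ∈ F := by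
  by_cases hr : ∃ r, 1 ≤ r ∧ r ≤ y ∧ x * r ≡ n [MOD y]
  · obtain ⟨r, hr1, hry, hr⟩ := hr
    refine ⟨(Finset.range (n / (x * y))).image fun t =>
      {x * y, x * (r + y * t), n - x * y - x * (r + y * t)},
      Finset.card_image_le.trans (by rw [Finset.card_range]), ?_⟩
    intro b hx hy hb hxy hlt hdvd
    have hbn : x * b ≡ n [MOD y] := by
      have h1 : y ∣ n - x * b := by
        have : n - x * b = (n - x * y - x * b) + x * y := by omega
        rw [this]
        exact dvd_add hdvd (Dvd.intro_left _ rfl)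
      exact (Nat.modEq_iff_dvd' (by omega)).2 h1
    have hrb : r ≡ b [MOD y] :=
      Nat.ModEq.cancel_left_of_coprime hxy.symm (hr.trans hbn.symm)
    have hle : r ≤ b := by
      by_contra! hlt'
      have h1 := (Nat.modEq_iff_dvd' hlt'.le).1 hrb.symm
      have := Nat.le_of_dvd (by omega) h1
      omega
    obtain ⟨t, ht⟩ := (Nat.modEq_iff_dvd' hle).1 hrb
    have hbt : b = r + y * t := by omega
    refine Finset.mem_image.2 ⟨t, Finset.mem_range.2 ?_, by rw [hbt]⟩
    rw [Nat.lt_iff_add_one_le, Nat.le_div_iff_mul_le (Nat.mul_pos hx hy)]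
    subst hbt
    nlinarith [Nat.zero_le (x * r)]
  · refine ⟨∅, by simp, ?_⟩
    intro b hx hy hb hxy hlt hdvd
    refine absurd ⟨(b - 1) % y + 1, by omega, Nat.succ_le_of_lt (Nat.mod_lt _ hy), ?_⟩ hr
    have h1 : (b - 1) % y + 1 ≡ b [MOD y] := by
      have := (Nat.mod_modEq (b - 1) y).add_right 1
      rwa [Nat.sub_add_cancel hb] at this
    refine (h1.mul_left x).trans ((Nat.modEq_iff_dvd' (by omega)).2 ?_)
    have : n - x * b = (n - x * y - x * b) + x * y := by omega
    rw [this]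
    exact dvd_add hdvd (Dvd.intro_left _ rfl)

theorem exists_lcm_finset (n : ℕ) :
    ∃ F : Finset (Multiset ℕ), (∀ T, T.sum = n → IsLcmTriple T → T ∈ F) ∧
      (F.card : ℝ) ≤ n * (1 + (harmonic n : ℝ) ^ 2 / 2) := by
  choose G hG hmem using exists_finset_progression n
  refine ⟨G 1 1 ∪ (Finset.range n).biUnion fun y => (Finset.range y).biUnion fun x =>
    G (x + 1) (y + 1), ?_, ?_⟩
  · rintro T hT ⟨a, b, c, rfl, ha, hb, hc, -, hdvd⟩
    have hsum : a + b + c = n := by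
      simpa [add_assoc] using hT
    have key : ∀ x y b c, x < y ∨ (x = 1 ∧ y = 1) → a = x * y → Nat.Coprime x y → x ∣ b → y ∣ c →
        0 < b → 0 < c → a + b + c = n → ({a, b, c} : Multiset ℕ) ∈
          G 1 1 ∪ (Finset.range n).biUnion fun y => (Finset.range y).biUnion fun x =>
            G (x + 1) (y + 1) := by
      rintro x y b c hxy rfl hcop ⟨b, rfl⟩ hyc hb hc rfl
      have hx : 0 < x := Nat.pos_of_mul_pos_right ha
      have hy : 0 < y := Nat.pos_of_mul_pos_left ha
      have hsub : x * y + x * b + c - x * y - x * b = c := by omega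
      have h := hmem x y b hx hy (Nat.pos_of_mul_pos_left hb) hcop (by omega)
        (by rw [hsub]; exact hyc)
      rw [hsub] at h
      rcases hxy with hxy | ⟨rfl, rfl⟩
      · refine Finset.mem_union_right _ (Finset.mem_biUnion.2 ⟨y - 1, Finset.mem_range.2 ?_,
          Finset.mem_biUnion.2 ⟨x - 1, Finset.mem_range.2 (by omega), ?_⟩⟩)
        · have := Nat.le_mul_of_pos_left y hx
          omega
        · rwa [Nat.sub_add_cancel hx, Nat.sub_add_cancel hy]
      · exact Finset.mem_union_left _ h
    obtain ⟨x, y, hxy, hcop, hxb, hyc⟩ := exists_mul_dvd_of_dvd_lcm hb.ne' hc.ne' hdvd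
    rcases lt_trichotomy x y with hlt | rfl | hlt
    · exact key x y b c (Or.inl hlt) hxy hcop hxb hyc hb hc hsum
    · have : x = 1 := by simpa using hcop
      exact key x x b c (Or.inr ⟨this, this⟩) hxy hcop hxb hyc hb hc hsum
    · have h := key y x c b (Or.inl hlt) (by rw [hxy, mul_comm]) hcop.symm hyc hxb hc hb (by omega)
      rwa [show ({a, b, c} : Multiset ℕ) = {a, c, b} from congrArg _ (pair_swap b c)]
  · have hdiv : ∀ x y : ℕ, ((G (x + 1) (y + 1)).card : ℝ) ≤
        n * (1 / (((x : ℝ) + 1) * ((y : ℝ) + 1))) := by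
      intro x y
      refine (Nat.cast_le.2 (hG _ _)).trans (Nat.cast_div_le.trans (le_of_eq ?_))
      push_cast
      ring
    have h1 : ((G 1 1).card : ℝ) ≤ n := by
      simpa using hdiv 0 0
    have h2 : (((Finset.range n).biUnion fun y => (Finset.range y).biUnion fun x =>
        G (x + 1) (y + 1)).card : ℝ) ≤ ∑ y ∈ Finset.range n, ∑ x ∈ Finset.range y,
          n * (1 / (((x : ℝ) + 1) * ((y : ℝ) + 1))) := by
      refine (Nat.cast_le.2 Finset.card_biUnion_le).trans ?_
      rw [Nat.cast_sum]
      refine Finset.sum_le_sum fun y _ => (Nat.cast_le.2 Finset.card_biUnion_le).trans ?_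
      rw [Nat.cast_sum]
      exact Finset.sum_le_sum fun x _ => hdiv x y
    simp only [← Finset.mul_sum] at h2
    have h3 := mul_le_mul_of_nonneg_left (sum_sum_div_le_harmonic_sq n) (Nat.cast_nonneg (α := ℝ) n)
    have h4 := Finset.card_union_le (G 1 1)
      ((Finset.range n).biUnion fun y => (Finset.range y).biUnion fun x => G (x + 1) (y + 1))
    have h5 : ((G 1 1 ∪ (Finset.range n).biUnion fun y => (Finset.range y).biUnion fun x =>
        G (x + 1) (y + 1)).card : ℝ) ≤ (G 1 1).card + ((Finset.range n).biUnion fun y =>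
          (Finset.range y).biUnion fun x => G (x + 1) (y + 1)).card := by
      exact_mod_cast h4
    rw [mul_add, mul_one]
    linarith

end Counting

section Existence

theorem isCycleSet_map_finRotate {α : Type*} [Finite α] {g : Equiv.Perm α} {a : ℕ}
    (f : Fin (a + 1) ↪ α) (h : ∀ i, g (f i) = f (finRotate (a + 1) i)) :
    IsCycleSet g (Finset.univ.map f) := by
  have hpow : ∀ (k : ℕ) (i : Fin (a + 1)), (g ^ k) (f i) = f ((finRotate (a + 1))^[k] i) := by
    intro k
    induction k with
    | zero => simp
    | succ k ih =>
      intro i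
      rw [pow_succ, Equiv.Perm.mul_apply, h, ih, Function.iterate_succ_apply]
  refine ⟨f 0, fun y => ?_⟩
  simp only [Finset.mem_map, Finset.mem_univ, true_and]
  constructor
  · rintro ⟨i, rfl⟩
    refine ⟨i.1, ?_⟩
    rw [zpow_natCast, hpow, ← finCycle_eq_finRotate_iterate, finCycle_apply, zero_add]
  · intro hy
    obtain ⟨k, rfl⟩ := hy.exists_nat_pow_eq
    exact ⟨_, (hpow k 0).symm⟩

/-- For positive `a + b + c = n` there is a permutation with cycles of lengths `a`, `b`, `c`. -/
theorem exists_threeCycles {a b c n : ℕ} (ha : 0 < a) (hb : 0 < b) (hc : 0 < c)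
    (h : a + b + c = n) :
    ∃ (g : Equiv.Perm (Fin n)) (A B C : Finset (Fin n)), ThreeCycles g A B C ∧ A.card = a ∧
      B.card = b ∧ C.card = c ∧ Equiv.Perm.sign g = (-1) ^ (n - 3) := by
  obtain ⟨a, rfl⟩ := Nat.exists_eq_succ_of_ne_zero ha.ne'
  obtain ⟨b, rfl⟩ := Nat.exists_eq_succ_of_ne_zero hb.ne'
  obtain ⟨c, rfl⟩ := Nat.exists_eq_succ_of_ne_zero hc.ne'
  have e : (Fin (a + 1) ⊕ Fin (b + 1)) ⊕ Fin (c + 1) ≃ Fin n :=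
    Fintype.equivOfCardEq (by simpa using h)
  let σ : Equiv.Perm ((Fin (a + 1) ⊕ Fin (b + 1)) ⊕ Fin (c + 1)) :=
    Equiv.Perm.sumCongr (Equiv.Perm.sumCongr (finRotate (a + 1)) (finRotate (b + 1)))
      (finRotate (c + 1))
  let fA : Fin (a + 1) ↪ Fin n := 
    (Function.Embedding.inl.trans Function.Embedding.inl).trans e.toEmbedding
  let fB : Fin (b + 1) ↪ Fin n := 
    (Function.Embedding.inr.trans Function.Embedding.inl).trans e.toEmbedding
  let fC : Fin (c + 1) ↪ Fin n := Function.Embedding.inr.trans e.toEmbedding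
  refine ⟨e.permCongr σ, Finset.univ.map fA, Finset.univ.map fB, Finset.univ.map fC,
    ⟨isCycleSet_map_finRotate fA ?_, isCycleSet_map_finRotate fB ?_,
      isCycleSet_map_finRotate fC ?_, ?_, ?_, ?_, ?_⟩, by simp, by simp, by simp, ?_⟩
  · intro i
    simp [fA, σ, Equiv.permCongr_apply]
  · intro i
    simp [fB, σ, Equiv.permCongr_apply]
  · intro i
    simp [fC, σ, Equiv.permCongr_apply]
  · simp [Finset.disjoint_left, fA, fB]
  · simp [Finset.disjoint_left, fA, fC]
  · simp [Finset.disjoint_left, fB, fC]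
  · intro y
    obtain ⟨x, rfl⟩ := e.surjective y
    rcases x with (x | x) | x <;> simp [fA, fB, fC]
  · rw [Equiv.Perm.sign_permCongr, Equiv.Perm.sign_sumCongr, Equiv.Perm.sign_sumCongr,
      sign_finRotate, sign_finRotate, sign_finRotate, ← pow_add, ← pow_add]
    congr 1
    omega

theorem exists_of_mem_coprimeTriples {n : ℕ} {T : Multiset ℕ} (hT : T ∈ coprimeTriples n) :
    ∃ a b c, T = {a, b, c} ∧ 0 < a ∧ 0 < b ∧ 0 < c ∧ a + b + c = n ∧
      Nat.gcd a (Nat.gcd b c) = 1 := by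
  obtain ⟨⟨a, b⟩, hw, rfl⟩ := Finset.mem_image.1 hT
  simp only [coprimePairs, Finset.mem_filter, Finset.mem_product, Finset.mem_Ioc] at hw
  obtain ⟨⟨⟨ha, -⟩, hb, -⟩, hlt, hgcd⟩ := hw
  refine ⟨a, b, n - a - b, rfl, ha, hb, by omega, by omega, ?_⟩
  refine Nat.dvd_one.1 (hgcd ▸ Nat.dvd_gcd (Nat.gcd_dvd_left _ _) (Nat.dvd_gcd ?_ ?_))
  · exact (Nat.gcd_dvd_right _ _).trans (Nat.gcd_dvd_left _ _)
  · have hn : n = a + (b + (n - a - b)) := by omega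
    have h1 := Nat.gcd_dvd_left a (Nat.gcd b (n - a - b))
    have h2 := Nat.gcd_dvd_right a (Nat.gcd b (n - a - b))
    have h3 := dvd_add h1 (dvd_add (h2.trans (Nat.gcd_dvd_left _ _))
      (h2.trans (Nat.gcd_dvd_right _ _)))
    rwa [← hn] at h3

end Existence

section Assembly

open Finset in
/-- A bound for the number of coprime triples in terms of the number of components of a family of
subgroups whose conjugates contain all permutations with three cycles. -/
theorem card_coprimeTriples_le {n s : ℕ} (hn : 577 ≤ n) (H : Fin s → Subgroup (Equiv.Perm (Fin n)))
    (hH : ∀ g, Equiv.Perm.sign g = (-1) ^ (n - 3) →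
      ∃ i x, x * g * x⁻¹ ∈ H i ∧ ¬ alternatingGroup (Fin n) ≤ H i)
    {F G L : Finset (Multiset ℕ)} (hF : ∀ T, IsImprimitiveTriple n T → T ∈ F)
    (hG : ∀ T, IsBalancedTriple n T → T ∈ G) (hL : ∀ T, T.sum = n → IsLcmTriple T → T ∈ L) :
    ∃ t ≤ s, 2 * (coprimeTriples n).card + t ^ 2 ≤
      t * (n + 1) + 2 * (F.card + G.card + L.card) := by
  classical
  let P : Fin s → ℕ → Prop := fun i k => 1 ≤ k ∧ 2 * k ≤ n ∧ ∀ g ∈ H i, ∀ A B C,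
    ThreeCycles g A B C → k ∈ ({A.card, B.card, C.card} : Multiset ℕ) ∨
      n - k ∈ ({A.card, B.card, C.card} : Multiset ℕ)
  let κ : Fin s → ℕ := fun i => if h : ∃ k, P i k then h.choose else 0
  have hκ : ∀ i, (∃ k, P i k) → P i (κ i) := by
    intro i h
    simp only [κ, dif_pos h]
    exact h.choose_spec
  let S : Finset ℕ := (univ.filter fun i => ∃ k, P i k).image κ
  have hS : ∀ k ∈ S, 1 ≤ k ∧ 2 * k ≤ n := by
    intro k hk
    obtain ⟨i, hi, rfl⟩ := mem_image.1 hk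
    have := hκ i (mem_filter.1 hi).2
    exact ⟨this.1, this.2.1⟩
  have hScard : S.card ≤ s := by
    simpa using card_image_le.trans (card_le_univ (univ.filter fun i => ∃ k, P i k))
  have hsub : coprimeTriples n ⊆ S.biUnion (triplesThrough n) ∪ (F ∪ G ∪ L) := by
    intro T hT
    obtain ⟨a, b, c, rfl, ha, hb, hc, hsum, hgcd⟩ := exists_of_mem_coprimeTriples hT
    obtain ⟨g, A, B, C, h, rfl, rfl, rfl, hsign⟩ := exists_threeCycles ha hb hc hsum
    obtain ⟨i, x, hx, hAlt⟩ := hH g hsign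
    have h' := h.conj x
    rcases exists_card_mem_or_forall_triple hAlt (by simpa using hn) with ⟨k, hk⟩ | hk
    · have hi : ∃ k, P i k := ⟨k, by simpa only [Fintype.card_fin] using hk⟩
      have hP := hκ i hi
      have h1 := hP.2.2 _ hx _ _ _ h'
      simp only [card_map] at h1
      exact mem_union_left _ (mem_biUnion.2 ⟨κ i, mem_image.2 ⟨i, by simpa using hi, rfl⟩,
        mem_triplesThrough ha hb hc hsum h1 (by have := hP.2.1; omega)⟩)
    · have h1 := hk _ hx _ _ _ h' (by simpa only [card_map] using hgcd)
      simp only [card_map, Fintype.card_fin] at h1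
      refine mem_union_right _ ?_
      rcases h1 with h1 | h1 | h1
      · exact mem_union_left _ (mem_union_left _ (hF _ h1))
      · exact mem_union_right _ (hL _ (by simpa [add_assoc] using hsum) h1)
      · exact mem_union_left _ (mem_union_right _ (hG _ h1))
  have h1 := card_le_card hsub
  have h2 := card_union_le (S.biUnion (triplesThrough n)) (F ∪ G ∪ L)
  have h3 := card_union_le (F ∪ G) L
  have h4 := card_union_le F G
  have h5 := card_biUnion_triplesThrough_le S hS
  exact ⟨S.card, hScard, by omega⟩

theorem exists_family_of_normalCoveringNumber {G : Type*} [Group G] [Finite G]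
    (hG : ¬ IsCyclic G) :
    ∃ H : Fin (normalCoveringNumber G) → Subgroup G, (∀ i, H i ≠ ⊤) ∧
      ∀ g : G, ∃ i, ∃ x : G, x * g * x⁻¹ ∈ H i := by
  refine Nat.sInf_mem (s := {s : ℕ | ∃ H : Fin s → Subgroup G, (∀ i, H i ≠ ⊤) ∧
    ∀ g : G, ∃ i : Fin s, ∃ x : G, x * g * x⁻¹ ∈ H i}) ?_
  let e := Finite.equivFin G
  refine ⟨Nat.card G, fun i => Subgroup.zpowers (e.symm i), fun i hi => hG ?_, fun g => ?_⟩
  · exact isCyclic_iff_exists_zpowers_eq_top.2 ⟨_, hi⟩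
  · exact ⟨e g, 1, by simp⟩

theorem exists_family_perm {n : ℕ} (hn : 4 ≤ n) (he : Even n) :
    ∃ H : Fin (normalCoveringNumber (Equiv.Perm (Fin n))) → Subgroup (Equiv.Perm (Fin n)),
      ∀ g, Equiv.Perm.sign g = (-1) ^ (n - 3) →
        ∃ i x, x * g * x⁻¹ ∈ H i ∧ ¬ alternatingGroup (Fin n) ≤ H i := by
  have hcyc : ¬ IsCyclic (Equiv.Perm (Fin n)) := by
    intro h
    have h3 := (alternatingGroup.isCyclic_iff_card_le_three (α := Fin n)).1 inferInstance
    simp only [Nat.card_eq_fintype_card, Fintype.card_fin] at h3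
    omega
  obtain ⟨H, hH, hcov⟩ := exists_family_of_normalCoveringNumber hcyc
  refine ⟨H, fun g hg => ?_⟩
  obtain ⟨i, x, hx⟩ := hcov g
  refine ⟨i, x, hx, fun hle => hH i (eq_top_iff.2 fun y _ => ?_)⟩
  have hodd : Odd (n - 3) := by
    obtain ⟨m, rfl⟩ := he
    exact ⟨m - 2, by omega⟩
  rw [hodd.neg_one_pow] at hg
  rcases Int.units_eq_one_or (Equiv.Perm.sign y) with hy | hy
  · exact hle hy
  · have h1 : y * (x * g * x⁻¹)⁻¹ ∈ H i := hle (by simp [hy, hg])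
    exact (Subgroup.mul_mem_cancel_right _ (inv_mem hx)).1 h1

theorem exists_family_alternatingGroup {n : ℕ} (hn : 5 ≤ n) (ho : Odd n) :
    ∃ H : Fin (normalCoveringNumber (alternatingGroup (Fin n))) → Subgroup (Equiv.Perm (Fin n)),
      ∀ g, Equiv.Perm.sign g = (-1) ^ (n - 3) →
        ∃ i x, x * g * x⁻¹ ∈ H i ∧ ¬ alternatingGroup (Fin n) ≤ H i := by
  have hcyc : ¬ IsCyclic (alternatingGroup (Fin n)) := by
    rw [alternatingGroup.isCyclic_iff_card_le_three, Nat.card_eq_fintype_card, Fintype.card_fin]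
    omega
  obtain ⟨H, hH, hcov⟩ := exists_family_of_normalCoveringNumber hcyc
  refine ⟨fun i => (H i).map (alternatingGroup (Fin n)).subtype, fun g hg => ?_⟩
  have heven : Even (n - 3) := by
    obtain ⟨m, rfl⟩ := ho
    exact ⟨m - 1, by omega⟩
  rw [heven.neg_one_pow] at hg
  obtain ⟨i, x, hx⟩ := hcov ⟨g, hg⟩
  refine ⟨i, x, ⟨_, hx, rfl⟩, fun hle => hH i (eq_top_iff.2 fun y _ => ?_)⟩
  obtain ⟨z, hz, hzy⟩ := hle y.2
  rwa [← Subtype.ext hzy]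

end Assembly

section Estimates

theorem harmonic_nonneg (n : ℕ) : (0 : ℝ) ≤ (harmonic n : ℝ) := by
  rw [harmonic, Rat.cast_sum]
  exact Finset.sum_nonneg fun i _ => by positivity

theorem harmonic_le_of_pow_four {n : ℕ} (hn : 6 ≤ n) {w : ℝ} (hw : 0 < w) (h : (n : ℝ) = w ^ 4) :
    (harmonic n : ℝ) ≤ 3.61 + 0.706 * w := by
  have h1 := harmonic_le_log_add hn
  have h2 : Real.log n = 4 * Real.log w := by
    rw [h, Real.log_pow]
    norm_num
  have h3 : Real.log w = Real.log (w / (17 / 3)) + Real.log (17 / 3) := by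
    rw [← Real.log_mul (by positivity) (by norm_num), div_mul_cancel₀ _ (by norm_num)]
  have h4 := Real.log_le_sub_one_of_pos (show 0 < w / (17 / 3) by positivity)
  have h5 : 2 * Real.log (17 / 3) = 5 * Real.log 2 + Real.log (289 / 288) := by
    have h6 : (2 : ℝ) * Real.log (17 / 3) = Real.log ((17 / 3) ^ 2) := by
      rw [Real.log_pow]
      norm_num
    have h7 : (5 : ℝ) * Real.log 2 = Real.log (2 ^ 5) := by
      rw [Real.log_pow]
      norm_num
    rw [h6, h7, ← Real.log_mul (by norm_num) (by norm_num)]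
    norm_num
  have h6 := Real.log_le_sub_one_of_pos (show (0 : ℝ) < 289 / 288 by norm_num)
  have h7 := Real.log_two_lt_d9
  linarith

theorem half_harmonic_sq_le {n : ℕ} (hn : 6 ≤ n) {w : ℝ} (hw : 0 < w) (h : (n : ℝ) = w ^ 4) :
    (harmonic n : ℝ) ^ 2 / 2 ≤ 6.52 + 2.549 * w + 0.2493 * w ^ 2 := by
  have h1 := harmonic_le_of_pow_four hn hw h
  have h2 := pow_le_pow_left₀ (harmonic_nonneg n) h1 2
  nlinarith [sq_nonneg w]

theorem card_balanced_bound_le {n : ℕ} {t : ℝ} (ht : 0 ≤ t) (h : (n : ℝ) = t ^ 2) :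
    ((((8 * n).sqrt / 3 + 1) * ((8 * n).sqrt / 2 + 1) : ℕ) : ℝ) ≤ 4 / 3 * t ^ 2 + 2.36 * t + 1 := by
  have h1 : (((8 * n).sqrt : ℕ) : ℝ) ^ 2 ≤ 8 * t ^ 2 := by
    rw [← h]
    exact_mod_cast Nat.sqrt_le' (8 * n)
  set R : ℝ := (((8 * n).sqrt : ℕ) : ℝ) with hR
  have hR0 : 0 ≤ R := Nat.cast_nonneg _
  have h2 : R ≤ 2.832 * t := by
    by_contra! hlt
    nlinarith
  have h3 : ((((8 * n).sqrt / 3 : ℕ)) : ℝ) ≤ R / 3 := by exact_mod_cast Nat.cast_div_le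
  have h4 : ((((8 * n).sqrt / 2 : ℕ)) : ℝ) ≤ R / 2 := by exact_mod_cast Nat.cast_div_le
  push_cast at h3 h4 ⊢
  calc _ ≤ (R / 3 + 1) * (R / 2 + 1) := by gcongr
    _ ≤ _ := by nlinarith

theorem error_le_of_even {n : ℕ} {t h g l : ℝ} (ht : 32 ≤ t) (hn : (n : ℝ) = t ^ 2)
    (hh : h ≤ t ^ 2 * (t - 1)) (hg : g ≤ 4 / 3 * t ^ 2 + 2.36 * t + 1)
    (hl : l ≤ n * (1 + (harmonic n : ℝ) ^ 2 / 2)) :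
    h + g + l + n / 4 ≤ 2 * t ^ 3 + 2 := by
  have ht0 : 0 < t := by linarith
  obtain ⟨w, hw, rfl⟩ : ∃ w : ℝ, 0 < w ∧ t = w ^ 2 :=
    ⟨√t, Real.sqrt_pos.2 ht0, (Real.sq_sqrt ht0.le).symm⟩
  have hw1 : 5.65 ≤ w := by
    by_contra! hlt
    nlinarith
  have hn6 : 6 ≤ n := by
    have : (6 : ℝ) ≤ n := by rw [hn]; nlinarith
    exact_mod_cast this
  have hH := half_harmonic_sq_le hn6 hw (by rw [hn]; ring)
  have h1 : (harmonic n : ℝ) ^ 2 / 2 + 1.658 ≤ w ^ 2 := by nlinarith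
  have h2 : l ≤ (w ^ 2) ^ 2 * (1 + (w ^ 2 - 1.658)) :=
    hl.trans (by rw [hn]; gcongr; linarith)
  rw [hn]
  nlinarith

theorem error_le_of_odd {n : ℕ} {t h g l : ℝ} (ht : 24 ≤ t) (hn : (n : ℝ) = t ^ 2)
    (hh : h ≤ t ^ 2 * (t - 1) / 2) (hg : g ≤ 4 / 3 * t ^ 2 + 2.36 * t + 1)
    (hl : l ≤ n * (1 + (harmonic n : ℝ) ^ 2 / 2)) :
    h + g + l + n / 4 ≤ 2 * t ^ 3 + 2 := by
  have ht0 : 0 < t := by linarith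
  obtain ⟨w, hw, rfl⟩ : ∃ w : ℝ, 0 < w ∧ t = w ^ 2 :=
    ⟨√t, Real.sqrt_pos.2 ht0, (Real.sq_sqrt ht0.le).symm⟩
  have hw1 : 4.89 ≤ w := by
    by_contra! hlt
    nlinarith
  have hn6 : 6 ≤ n := by
    have : (6 : ℝ) ≤ n := by rw [hn]; nlinarith
    exact_mod_cast this
  have hH := half_harmonic_sq_le hn6 hw (by rw [hn]; ring)
  have h1 : (harmonic n : ℝ) ^ 2 / 2 + 2.19 ≤ 1.5 * w ^ 2 := by nlinarith
  have h2 : l ≤ (w ^ 2) ^ 2 * (1 + (1.5 * w ^ 2 - 2.19)) :=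
    hl.trans (by rw [hn]; gcongr; linarith)
  rw [hn]
  nlinarith

theorem prod_factor_mem (p : ℕ) : 0 ≤ 1 - 1 / (p : ℝ) ^ 2 ∧ 1 - 1 / (p : ℝ) ^ 2 ≤ 1 := by
  rcases Nat.eq_zero_or_pos p with rfl | hp
  · simp
  · have h1 : (1 : ℝ) ≤ p := by exact_mod_cast hp
    have h2 : 1 / (p : ℝ) ^ 2 ≤ 1 := by
      rw [div_le_one (by positivity)]
      exact one_le_pow₀ h1
    have h3 : 0 ≤ 1 / (p : ℝ) ^ 2 := by positivity
    constructor <;> linarith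

theorem zeta2_le (n : ℕ) : zeta2 n ≤ 1 / 12 := by
  have := Finset.prod_le_one (s := n.primeFactors) (fun p _ => (prod_factor_mem p).1)
    (fun p _ => (prod_factor_mem p).2)
  rw [zeta2]
  linarith

theorem zeta2_le_of_even {n : ℕ} (hn : n ≠ 0) (he : Even n) : zeta2 n ≤ 1 / 16 := by
  have h2 : 2 ∈ n.primeFactors := Nat.mem_primeFactors.2 ⟨Nat.prime_two, he.two_dvd, hn⟩
  have := Finset.prod_le_one (s := n.primeFactors.erase 2) (fun p _ => (prod_factor_mem p).1)
    (fun p _ => (prod_factor_mem p).2)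
  rw [zeta2, ← Finset.mul_prod_erase _ _ h2]
  norm_num at this ⊢
  linarith

theorem le_fAux {n : ℕ} (hn : 0 < n) : 2 / (n : ℝ) ^ 2 + 2 / √n ≤ fAux n := by
  have h1 : (1 : ℝ) ≤ n := by exact_mod_cast hn
  rw [fAux, ← Real.sqrt_eq_rpow]
  split_ifs
  · have h2 : 0 ≤ Real.logb 3 n := Real.logb_nonneg (by norm_num) h1
    have : 0 ≤ (1 / (n : ℝ) ^ 2) * ((Real.logb 3 n + 1) / 4) * ((n - 1).primeFactors.card) := by
      positivity
    linarith
  · have h2 : 0 ≤ Real.logb 2 n := Real.logb_nonneg (by norm_num) h1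
    have : 0 ≤ (1 / (n : ℝ) ^ 2) * ((Real.logb 2 n + 1) / 2) * ((n - 1).primeFactors.card) := by
      positivity
    linarith

theorem two_mul_sqrt_pow_add_le {n : ℕ} (hn : 0 < n) : 2 * √n ^ 3 + 2 ≤ (n : ℝ) ^ 2 * fAux n := by
  have h1 : (0 : ℝ) < √n := Real.sqrt_pos.2 (by exact_mod_cast hn)
  have h2 : (n : ℝ) = √n ^ 2 := (Real.sq_sqrt (Nat.cast_nonneg n)).symm
  have h3 := mul_le_mul_of_nonneg_left (le_fAux hn) (sq_nonneg (n : ℝ))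
  refine le_trans (le_of_eq ?_) h3
  set t := √(n : ℝ)
  rw [h2]
  field_simp
  ring

theorem ceil_le_of_mul_sub_le {n s : ℕ} {z f : ℝ}
    (h : f < z → 2 * s ≤ n + 1 → 2 * ((n : ℝ) ^ 2 * (z - f)) ≤ s * (n + 1 - s)) :
    (s : ℤ) ≥ ⌈((n : ℝ) + 1) / 2 * (1 - Real.sqrt (1 - 8 * z + 8 * f +
      (16 * (n : ℝ) + 8) / ((n : ℝ) + 1) ^ 2 * (z - f)))⌉ := by
  have hn : (0 : ℝ) < (n : ℝ) + 1 := by positivity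
  have hQ : 1 - 8 * z + 8 * f + (16 * (n : ℝ) + 8) / ((n : ℝ) + 1) ^ 2 * (z - f) =
      1 - 8 * ((n : ℝ) ^ 2 * (z - f)) / ((n : ℝ) + 1) ^ 2 := by
    field_simp
    ring
  rw [ge_iff_le, Int.ceil_le, Int.cast_natCast, hQ]
  suffices 1 - 2 * (s : ℝ) / (n + 1) ≤
      Real.sqrt (1 - 8 * ((n : ℝ) ^ 2 * (z - f)) / ((n : ℝ) + 1) ^ 2) by
    calc _ ≤ ((n : ℝ) + 1) / 2 * (2 * (s : ℝ) / (n + 1)) := by gcongr; linarith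
      _ = s := by field_simp
  by_cases hs : 2 * s ≤ n + 1
  swap
  · have h1 : (n : ℝ) + 1 ≤ 2 * s := by exact_mod_cast (not_le.1 hs).le
    refine le_trans ?_ (Real.sqrt_nonneg _)
    rw [sub_nonpos, le_div_iff₀ hn]
    linarith
  apply Real.le_sqrt_of_sq_le
  have hle : 2 * ((n : ℝ) ^ 2 * (z - f)) ≤ s * (n + 1 - s) := by
    by_cases hzf : f < z
    · exact h hzf hs
    · have h1 : (2 : ℝ) * s ≤ n + 1 := by exact_mod_cast hs
      have h2 : (n : ℝ) ^ 2 * (z - f) ≤ 0 :=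
        mul_nonpos_of_nonneg_of_nonpos (sq_nonneg _) (by linarith)
      have h3 : (0 : ℝ) ≤ s * (n + 1 - s) := mul_nonneg (Nat.cast_nonneg _) (by
        have : (0 : ℝ) ≤ s := Nat.cast_nonneg _
        linarith)
      linarith
  have h1 : (1 - 2 * (s : ℝ) / (n + 1)) ^ 2 = 1 - 4 * (s * (n + 1 - s)) / ((n : ℝ) + 1) ^ 2 := by
    field_simp
    ring
  rw [h1]
  refine sub_le_sub_left (div_le_div_of_nonneg_right ?_ (sq_nonneg _)) 1
  linarith

end Estimates

section Main

theorem two_mul_sub_le {n s : ℕ} (hn : 577 ≤ n)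
    (hs : 2 * s ≤ n + 1) (H : Fin s → Subgroup (Equiv.Perm (Fin n)))
    (hH : ∀ g, Equiv.Perm.sign g = (-1) ^ (n - 3) →
      ∃ i x, x * g * x⁻¹ ∈ H i ∧ ¬ alternatingGroup (Fin n) ≤ H i)
    (herr : ∀ h g l : ℝ,
      2 * h ≤ (n.divisors.filter (fun m => 1 < m ∧ m < n)).card * √n ^ 2 →
      g ≤ 4 / 3 * √n ^ 2 + 2.36 * √n + 1 → l ≤ n * (1 + (harmonic n : ℝ) ^ 2 / 2) →
      h + g + l + n / 4 ≤ 2 * √n ^ 3 + 2) :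
    2 * ((n : ℝ) ^ 2 * (zeta2 n - fAux n)) ≤ s * (n + 1 - s) := by
  have ht : (n : ℝ) = √n ^ 2 := (Real.sq_sqrt (Nat.cast_nonneg n)).symm
  obtain ⟨F, hF, hFc⟩ := exists_imprimitive_finset n
  obtain ⟨G, hG, hGc⟩ := exists_balanced_finset n
  obtain ⟨L, hL, hLc⟩ := exists_lcm_finset n
  obtain ⟨t, hts, htc⟩ := card_coprimeTriples_le hn H hH hF hG hL
  have h1 := herr F.card G.card L.card (by rw [← ht]; exact_mod_cast hFc)
    ((Nat.cast_le.2 hGc).trans (card_balanced_bound_le (Real.sqrt_nonneg _) ht)) hLc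
  have h2 := two_mul_sqrt_pow_add_le (n := n) (by omega)
  have h3 := sq_mul_zeta2_le (n := n) (by omega)
  have h4 : 2 * ((coprimeTriples n).card : ℝ) + t ^ 2 ≤
      t * (n + 1) + 2 * (F.card + G.card + L.card) := by exact_mod_cast htc
  have h5 : (t : ℝ) ≤ s := by exact_mod_cast hts
  have h6 : 2 * (s : ℝ) ≤ n + 1 := by exact_mod_cast hs
  nlinarith

theorem two_mul_sub_le_of_even {n s : ℕ} (h0 : n ≠ 0) (he : Even n) (hlt : fAux n < zeta2 n)
    (hs : 2 * s ≤ n + 1) (H : Fin s → Subgroup (Equiv.Perm (Fin n)))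
    (hH : ∀ g, Equiv.Perm.sign g = (-1) ^ (n - 3) →
      ∃ i x, x * g * x⁻¹ ∈ H i ∧ ¬ alternatingGroup (Fin n) ≤ H i) :
    2 * ((n : ℝ) ^ 2 * (zeta2 n - fAux n)) ≤ s * (n + 1 - s) := by
  have ht0 : (0 : ℝ) < √n := Real.sqrt_pos.2 (by exact_mod_cast Nat.pos_of_ne_zero h0)
  have ht : (n : ℝ) = √n ^ 2 := (Real.sq_sqrt (Nat.cast_nonneg n)).symm
  have h32 : 32 ≤ √(n : ℝ) := by
    have h1 := (le_fAux (Nat.pos_of_ne_zero h0)).trans (hlt.le.trans (zeta2_le_of_even h0 he))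
    have h2 : 0 ≤ 2 / (n : ℝ) ^ 2 := by positivity
    have h3 : 2 / √(n : ℝ) ≤ 1 / 16 := by linarith
    rw [div_le_iff₀ ht0] at h3
    linarith
  have hn : 577 ≤ n := by
    have : (577 : ℝ) ≤ n := by rw [ht]; nlinarith
    exact_mod_cast this
  refine two_mul_sub_le hn hs H hH fun h g l hh hg hl => error_le_of_even h32 ht ?_ hg hl
  have h1 := (card_proper_divisors_le n).trans (Nat.mul_le_mul_left 2 (card_small_divisors_le n))
  have h2 : ((n.sqrt : ℕ) : ℝ) ≤ √n := Real.nat_sqrt_le_real_sqrt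
  have h3 : ((n.divisors.filter (fun m => 1 < m ∧ m < n)).card : ℝ) + 2 ≤ 2 * n.sqrt := by
    have : 1 ≤ n.sqrt := Nat.le_sqrt'.2 (by omega)
    have h4 : (n.divisors.filter (fun m => 1 < m ∧ m < n)).card + 2 ≤ 2 * n.sqrt := by omega
    exact_mod_cast h4
  nlinarith [sq_nonneg √(n : ℝ)]

theorem two_mul_sub_le_of_odd {n s : ℕ} (ho : Odd n) (hlt : fAux n < zeta2 n)
    (hs : 2 * s ≤ n + 1) (H : Fin s → Subgroup (Equiv.Perm (Fin n)))
    (hH : ∀ g, Equiv.Perm.sign g = (-1) ^ (n - 3) →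
      ∃ i x, x * g * x⁻¹ ∈ H i ∧ ¬ alternatingGroup (Fin n) ≤ H i) :
    2 * ((n : ℝ) ^ 2 * (zeta2 n - fAux n)) ≤ s * (n + 1 - s) := by
  have ht0 : (0 : ℝ) < √n := Real.sqrt_pos.2 (by exact_mod_cast ho.pos)
  have ht : (n : ℝ) = √n ^ 2 := (Real.sq_sqrt (Nat.cast_nonneg n)).symm
  have h24 : 24 < √(n : ℝ) := by
    have h1 := (le_fAux ho.pos).trans_lt (hlt.trans_le (zeta2_le n))
    have h2 : 0 ≤ 2 / (n : ℝ) ^ 2 := by positivity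
    have h3 : 2 / √(n : ℝ) < 1 / 12 := by linarith
    rw [div_lt_iff₀ ht0] at h3
    linarith
  have hn : 577 ≤ n := by
    have : (576 : ℝ) < n := by rw [ht]; nlinarith
    exact_mod_cast this
  refine two_mul_sub_le hn hs H hH fun h g l hh hg hl => error_le_of_odd h24.le ht ?_ hg hl
  have h1 := (card_proper_divisors_le n).trans (card_small_divisors_le_of_odd ho)
  have h2 : ((n.sqrt : ℕ) : ℝ) ≤ √n := Real.nat_sqrt_le_real_sqrt
  have h3 : ((n.divisors.filter (fun m => 1 < m ∧ m < n)).card : ℝ) + 1 ≤ n.sqrt := by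
    have : 1 ≤ n.sqrt := Nat.le_sqrt'.2 (by omega)
    have h4 : (n.divisors.filter (fun m => 1 < m ∧ m < n)).card + 1 ≤ n.sqrt := by omega
    exact_mod_cast h4
  nlinarith [sq_nonneg √(n : ℝ)]

end Main

end NormalCovering

theorem gamma_lower_bound_ceil (n : ℕ) :
    (4 ≤ n → Even n →
      (normalCoveringNumber (Equiv.Perm (Fin n)) : ℤ) ≥
        ⌈((n : ℝ) + 1) / 2 *
          (1 - Real.sqrt (1 - 8 * zeta2 n + 8 * fAux n +
            (16 * (n : ℝ) + 8) / ((n : ℝ) + 1) ^ 2 * (zeta2 n - fAux n)))⌉) ∧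
    (5 ≤ n → Odd n →
      (normalCoveringNumber (alternatingGroup (Fin n)) : ℤ) ≥
        ⌈((n : ℝ) + 1) / 2 *
          (1 - Real.sqrt (1 - 8 * zeta2 n + 8 * fAux n +
            (16 * (n : ℝ) + 8) / ((n : ℝ) + 1) ^ 2 * (zeta2 n - fAux n)))⌉) := by
  refine ⟨fun hn he => NormalCovering.ceil_le_of_mul_sub_le fun hlt hs => ?_,
    fun hn ho => NormalCovering.ceil_le_of_mul_sub_le fun hlt hs => ?_⟩
  · obtain ⟨H, hH⟩ := NormalCovering.exists_family_perm hn he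
    exact NormalCovering.two_mul_sub_le_of_even (by omega) he hlt hs H hH
  · obtain ⟨H, hH⟩ := NormalCovering.exists_family_alternatingGroup hn ho
    exact NormalCovering.two_mul_sub_le_of_odd ho hlt hs H hH
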